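/- (Macaulay theorem for Clements–Lindström rings) Let a = (a_1,…,a_r) be a degree sequence, 𝔞 = (x_1^{a_1},…,x_r^{a_r}) ⊆ A = K[x_1,…,x_n], and R = A/𝔞. Let H : ℕ → ℕ be a numerical function with H(0) = 1 and H(1) ≤ n. Then H is the Hilbert function of R/I for some homogeneous ideal I of R if and only if H(d+1) ≤ (H(d))^{⟨d⟩}_a for all d ≥ 1. -/

import Mathlib

open MvPolynomial

section Defs

variable {K : Type*} [Field K]

/-- Total degree of an exponent vector. -/
def expDeg {n : ℕ} (m : Fin n →₀ ℕ) : ℕ := ∑ i, m i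

/-- `lexLe m m'` means `m ≤ m'` in the lexicographic order with `x_1 > x_2 > … > x_n`. -/
def lexLe {n : ℕ} (m m' : Fin n →₀ ℕ) : Prop :=
  m = m' ∨ ∃ i : Fin n, (∀ j : Fin n, j < i → m j = m' j) ∧ m i < m' i

/-- A lex-segment in degree `d`: an upward (w.r.t. lex) closed set of degree-`d`
exponent vectors. -/
def IsLexSegment (n d : ℕ) (S : Set (Fin n →₀ ℕ)) : Prop :=
  (∀ m ∈ S, expDeg m = d) ∧
    ∀ m ∈ S, ∀ m' : Fin n →₀ ℕ, expDeg m' = d → lexLe m m' → m' ∈ S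

/-- The pure-powers ideal `(x_1^{a_1}, …, x_r^{a_r})`. -/
noncomputable def purePowers (K : Type*) [Field K] {n r : ℕ} (hrn : r ≤ n)
    (a : Fin r → ℕ) : Ideal (MvPolynomial (Fin n) K) :=
  Ideal.span (Set.range fun i : Fin r => X (Fin.castLE hrn i) ^ a i)

/-- A homogeneous ideal. -/
def IsHomog {n : ℕ} (I : Ideal (MvPolynomial (Fin n) K)) : Prop :=
  ∀ f ∈ I, ∀ d : ℕ, homogeneousComponent d f ∈ I

/-- The degree-`d` component of an ideal, as a `K`-subspace. -/
noncomputable def component {n : ℕ} (I : Ideal (MvPolynomial (Fin n) K)) (d : ℕ) :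
    Submodule K (MvPolynomial (Fin n) K) :=
  Submodule.restrictScalars K I ⊓ homogeneousSubmodule (Fin n) K d

/-- Hilbert function of an ideal: `dim_K I_d`. -/
noncomputable def hilb {n : ℕ} (I : Ideal (MvPolynomial (Fin n) K)) (d : ℕ) : ℕ :=
  Module.finrank K ↥(component I d)

/-- An `a`-lpp (lex-plus-powers) ideal: a homogeneous (monomial) ideal each of whose graded
components is the span of a lex-segment plus the corresponding component of the
pure-powers ideal. -/
def IsLPP {n r : ℕ} (hrn : r ≤ n) (a : Fin r → ℕ)
    (J : Ideal (MvPolynomial (Fin n) K)) : Prop :=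
  IsHomog J ∧
    ∀ d : ℕ, ∃ S : Set (Fin n →₀ ℕ), IsLexSegment n d S ∧
      component J d =
        Submodule.span K ((fun m => (monomial m (1 : K) : MvPolynomial (Fin n) K)) '' S)
          ⊔ component (purePowers K hrn a) d

/-- `I` satisfies `EGH_a(d)`. -/
def EGHd {n r : ℕ} (hrn : r ≤ n) (a : Fin r → ℕ)
    (I : Ideal (MvPolynomial (Fin n) K)) (d : ℕ) : Prop :=
  ∃ J : Ideal (MvPolynomial (Fin n) K), IsLPP hrn a J ∧
    hilb J d = hilb I d ∧ hilb J (d + 1) ≤ hilb I (d + 1)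

/-- `I` satisfies `EGH_a`. -/
def EGH {n r : ℕ} (hrn : r ≤ n) (a : Fin r → ℕ)
    (I : Ideal (MvPolynomial (Fin n) K)) : Prop :=
  ∀ d : ℕ, EGHd hrn a I d

/-- A monomial ideal. -/
def IsMonomialIdeal {n : ℕ} (I : Ideal (MvPolynomial (Fin n) K)) : Prop :=
  ∃ M : Set (Fin n →₀ ℕ),
    I = Ideal.span ((fun m => (monomial m (1 : K) : MvPolynomial (Fin n) K)) '' M)

/-- A strongly stable (monomial) ideal. -/
def IsStronglyStable {n : ℕ} (S : Ideal (MvPolynomial (Fin n) K)) : Prop :=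
  IsMonomialIdeal S ∧
    ∀ (m : Fin n →₀ ℕ) (i j : Fin n), j ≤ i →
      (monomial (m + Finsupp.single i 1) (1 : K) : MvPolynomial (Fin n) K) ∈ S →
      (monomial (m + Finsupp.single j 1) (1 : K) : MvPolynomial (Fin n) K) ∈ S

/-- An `a`-spp (strongly-stable-plus-powers) ideal. -/
def IsSPP {n r : ℕ} (hrn : r ≤ n) (a : Fin r → ℕ)
    (J : Ideal (MvPolynomial (Fin n) K)) : Prop :=
  ∃ S : Ideal (MvPolynomial (Fin n) K), IsStronglyStable S ∧ J = S ⊔ purePowers K hrn a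

/-- A regular sequence: each `f i` is a non-zerodivisor modulo `(f j : j < i)`. -/
def IsRegSeq {n r : ℕ} (f : Fin r → MvPolynomial (Fin n) K) : Prop :=
  ∀ i : Fin r, ∀ g : MvPolynomial (Fin n) K,
    g * f i ∈ Ideal.span { p | ∃ j : Fin r, j < i ∧ p = f j } →
    g ∈ Ideal.span { p | ∃ j : Fin r, j < i ∧ p = f j }

/-- `I` contains a homogeneous regular sequence of degree `a`. -/
def ContainsRegSeq {n r : ℕ} (a : Fin r → ℕ)
    (I : Ideal (MvPolynomial (Fin n) K)) : Prop :=
  ∃ f : Fin r → MvPolynomial (Fin n) K,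
    (∀ i, f i ∈ I) ∧ IsRegSeq f ∧ ∀ i, (f i).IsHomogeneous (a i)

/-- `dim_K (N/P)` for ideals `P ≤ N` (the `K`-dimension of `N/(N ∩ P)`). -/
noncomputable def quotDim (K : Type*) [Field K] {n : ℕ}
    (N P : Ideal (MvPolynomial (Fin n) K)) : ℕ :=
  Module.finrank K
    (↥(Submodule.restrictScalars K N) ⧸
      Submodule.comap (Submodule.restrictScalars K N).subtype (Submodule.restrictScalars K P))

/-- `dim_K (I/F)_d`. -/
noncomputable def relHilb {n : ℕ} (I F : Ideal (MvPolynomial (Fin n) K)) (d : ℕ) : ℕ :=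
  Module.finrank K
    (↥(component I d) ⧸ Submodule.comap (component I d).subtype (Submodule.restrictScalars K F))

/-- `dim_K (A/I)_d`. -/
noncomputable def hilbQ {n : ℕ} (I : Ideal (MvPolynomial (Fin n) K)) (d : ℕ) : ℕ :=
  Module.finrank K
    (↥(homogeneousSubmodule (Fin n) K d) ⧸
      Submodule.comap (homogeneousSubmodule (Fin n) K d).subtype (Submodule.restrictScalars K I))

end Defs

/-- `[h;d]_a`: the dimension of the degree-`d` component of
`K[x_{n−h+1},…,x_n]/(x_i^{a_i} : n−h+1 ≤ i ≤ n)`, where `a_i = ∞` (no constraint)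
for `i > r`; it is `0` for `h = 0`.  Stated combinatorially by counting exponent vectors
supported on the last `h` variables whose `i`-th entry is `< a_i` whenever `i ≤ r`. -/
noncomputable def cldim {n r : ℕ} (hrn : r ≤ n) (a : Fin r → ℕ) (h d : ℕ) : ℕ :=
  { m : Fin n →₀ ℕ | expDeg m = d ∧ (∀ i : Fin n, (i : ℕ) < n - h → m i = 0) ∧
      ∀ i : Fin r, n - h ≤ (i : ℕ) → m (Fin.castLE hrn i) < a i }.ncard

/-- `MacRep hrn a d k c` says that `c 1, …, c d` (i.e. `k_1 ≤ … ≤ k_d`) is the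
`(a,n)`-Macaulay representation of `k` in base `d`:
`k = [k_d; d]_a + … + [k_1; 1]_a`, with `k_d ≥ … ≥ k_1 ≥ 0`,
`#{t : k_t = i} ≤ a_{n−i} − 1` for `0 ≤ i < n` (no condition when `a_{n−i} = ∞`,
i.e. `n − i > r`), and `#{t : k_t = n} ≤ 1`. -/
def MacRep {n r : ℕ} (hrn : r ≤ n) (a : Fin r → ℕ) (d k : ℕ) (c : ℕ → ℕ) : Prop :=
  k = ∑ t ∈ Finset.Icc 1 d, cldim hrn a (c t) t ∧
  (∀ t ∈ Finset.Icc 1 d, c t ≤ n) ∧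
  (∀ t t' : ℕ, 1 ≤ t → t ≤ t' → t' ≤ d → c t ≤ c t') ∧
  (∀ i : ℕ, ∀ hi : i < n, ∀ hir : n - i ≤ r,
    ((Finset.Icc 1 d).filter (fun t => c t = i)).card ≤ a ⟨n - i - 1, by omega⟩ - 1) ∧
  ((Finset.Icc 1 d).filter (fun t => c t = n)).card ≤ 1

namespace ClementsLindstrom

open Finset

/-- Exponent vectors of degree `d` with `i`-th entry `< a i`. -/
def box {n : ℕ} (a : Fin n → ℕ) (d : ℕ) : Finset (Fin n → ℕ) :=
  {u ∈ Fintype.piFinset fun i => range (a i) | ∑ i, u i = d}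

lemma mem_box {n : ℕ} {a : Fin n → ℕ} {d : ℕ} {u : Fin n → ℕ} :
    u ∈ box a d ↔ (∀ i, u i < a i) ∧ ∑ i, u i = d := by
  simp [box]

/-- The upper shadow of `S` inside the box bounded by `a`. -/
def upShadow {n : ℕ} (a : Fin n → ℕ) (S : Finset (Fin n → ℕ)) : Finset (Fin n → ℕ) :=
  {u ∈ (S ×ˢ univ).image fun p => p.1 + Pi.single p.2 1 | ∀ i, u i < a i}

lemma mem_upShadow {n : ℕ} {a : Fin n → ℕ} {S : Finset (Fin n → ℕ)} {u : Fin n → ℕ} :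
    u ∈ upShadow a S ↔ (∀ i, u i < a i) ∧ ∃ s ∈ S, ∃ i, u = s + Pi.single i 1 := by
  simp only [upShadow, mem_filter, mem_image, mem_product, mem_univ, and_true, Prod.exists]
  constructor
  · rintro ⟨⟨s, i, hs, rfl⟩, h⟩
    exact ⟨h, s, hs, i, rfl⟩
  · rintro ⟨h, s, hs, i, rfl⟩
    exact ⟨⟨s, i, hs, rfl⟩, h⟩

lemma upShadow_mono {n : ℕ} {a : Fin n → ℕ} {S T : Finset (Fin n → ℕ)} (h : S ⊆ T) :
    upShadow a S ⊆ upShadow a T := by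
  intro u hu
  rw [mem_upShadow] at hu ⊢
  obtain ⟨h1, s, hs, i, rfl⟩ := hu
  exact ⟨h1, s, h hs, i, rfl⟩

lemma sum_add_single {n : ℕ} (s : Fin n → ℕ) (i : Fin n) :
    ∑ l, (s + Pi.single i 1 : Fin n → ℕ) l = ∑ l, s l + 1 := by
  simp [sum_add_distrib]

lemma upShadow_subset_box {n : ℕ} {a : Fin n → ℕ} {d : ℕ} {S : Finset (Fin n → ℕ)}
    (h : S ⊆ box a d) : upShadow a S ⊆ box a (d + 1) := by
  intro u hu
  obtain ⟨h1, s, hs, i, rfl⟩ := mem_upShadow.1 hu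
  refine mem_box.2 ⟨h1, ?_⟩
  rw [sum_add_single, (mem_box.1 (h hs)).2]

lemma sub_single_add_single {n : ℕ} {u : Fin n → ℕ} {i : Fin n} (hi : 0 < u i) :
    u - Pi.single i 1 + Pi.single i 1 = u := by
  funext l
  by_cases hl : l = i
  · subst hl; simp; omega
  · simp [hl]

lemma exists_eq_add_single {n d : ℕ} {u : Fin n → ℕ} (hu : ∑ i, u i = d + 1) :
    ∃ (v : Fin n → ℕ) (i : Fin n), u = v + Pi.single i 1 ∧ ∑ i, v i = d := by
  obtain ⟨i, -, hi⟩ := exists_ne_zero_of_sum_ne_zero (by omega : ∑ i, u i ≠ 0)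
  have h := sub_single_add_single (Nat.pos_of_ne_zero hi)
  refine ⟨u - Pi.single i 1, i, h.symm, ?_⟩
  have := sum_add_single (u - Pi.single i 1) i
  rw [h] at this
  omega

lemma eq_of_le_of_sum_eq {n : ℕ} {u v : Fin n → ℕ} (h : ∀ l, u l ≤ v l)
    (hs : ∑ l, u l = ∑ l, v l) : u = v := by
  funext l
  exact (sum_eq_sum_iff_of_le fun i _ => h i).1 hs l (mem_univ l)

lemma toLex_lt_iff {n : ℕ} {u v : Fin n → ℕ} :
    toLex u < toLex v ↔ ∃ i, (∀ j, j < i → u j = v j) ∧ u i < v i := Iff.rfl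

lemma toLex_lt_add_single {n : ℕ} (s : Fin n → ℕ) (i : Fin n) :
    toLex s < toLex (s + Pi.single i 1) := by
  refine toLex_lt_iff.2 ⟨i, fun j hj => ?_, ?_⟩
  · simp [hj.ne]
  · simp

/-- If `s < t` lexicographically and `t` has one degree more, then some degree-one-less divisor
of `t` is still at least `s`. -/
lemma exists_add_single_eq {n : ℕ} {s t : Fin n → ℕ} (hlt : toLex s < toLex t)
    (hsum : ∑ l, t l = ∑ l, s l + 1) :
    ∃ j, ∃ v : Fin n → ℕ, t = v + Pi.single j 1 ∧ toLex s ≤ toLex v := by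
  obtain ⟨i, hi, hlt⟩ := toLex_lt_iff.1 hlt
  have key : ∀ j, 0 < t j → t = (t - Pi.single j 1) + Pi.single j 1 :=
    fun j hj => (sub_single_add_single hj).symm
  by_cases h : ∃ j, i < j ∧ 0 < t j
  · obtain ⟨j, hij, hj⟩ := h
    refine ⟨j, _, key j hj, le_of_lt (toLex_lt_iff.2 ⟨i, fun l hl => ?_, ?_⟩)⟩
    · simp [(hl.trans hij).ne, hi l hl]
    · simpa [Pi.single_apply, hij.ne] using hlt
  · push Not at h
    have hk := key i (by omega)
    refine ⟨i, _, hk, ?_⟩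
    by_cases h2 : s i < t i - 1
    · refine le_of_lt (toLex_lt_iff.2 ⟨i, fun l hl => ?_, ?_⟩)
      · simp [hl.ne, hi l hl]
      · simpa using h2
    · have : t - Pi.single i 1 = s := by
        apply eq_of_le_of_sum_eq
        · intro l
          rcases lt_trichotomy l i with hl | rfl | hl
          · simp [hl.ne, hi l hl]
          · simp; omega
          · simp [hl.ne']
            have := h l hl
            omega
        · have := sum_add_single (t - Pi.single i 1) i
          rw [← hk] at this
          omega
      rw [this]

/-- An upward closed subset, for the lexicographic order, of the degree-`d` part of the box. -/
def IsLexUpper {n : ℕ} (a : Fin n → ℕ) (d : ℕ) (L : Finset (Fin n → ℕ)) : Prop :=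
  L ⊆ box a d ∧ ∀ s ∈ L, ∀ t ∈ box a d, toLex s ≤ toLex t → t ∈ L

namespace IsLexUpper

variable {n : ℕ} {a : Fin n → ℕ} {d : ℕ} {L L' : Finset (Fin n → ℕ)}

lemma total (h : IsLexUpper a d L) (h' : IsLexUpper a d L') : L ⊆ L' ∨ L' ⊆ L := by
  by_contra! hc
  obtain ⟨⟨u, hu, hu'⟩, v, hv, hv'⟩ := And.imp not_subset.1 not_subset.1 hc
  rcases le_total (toLex u) (toLex v) with hl | hl
  · exact hv' (h.2 u hu v (h'.1 hv) hl)
  · exact hu' (h'.2 v hv u (h.1 hu) hl)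

lemma subset_of_card_le (h : IsLexUpper a d L) (h' : IsLexUpper a d L')
    (hc : #L ≤ #L') : L ⊆ L' := by
  rcases h.total h' with hs | hs
  · exact hs
  · exact (eq_of_subset_of_card_le hs hc).symm.subset

lemma eq_of_card_eq (h : IsLexUpper a d L) (h' : IsLexUpper a d L')
    (hc : #L = #L') : L = L' :=
  eq_of_subset_of_card_le (h.subset_of_card_le h' hc.le) hc.ge

lemma upShadow (h : IsLexUpper a d L) : IsLexUpper a (d + 1) (upShadow a L) := by
  refine ⟨upShadow_subset_box h.1, fun u hu t ht hut => ?_⟩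
  obtain ⟨-, s, hs, i, rfl⟩ := mem_upShadow.1 hu
  obtain ⟨ht1, ht2⟩ := mem_box.1 ht
  have hsd := (mem_box.1 (h.1 hs)).2
  obtain ⟨j, v, rfl, hv⟩ := exists_add_single_eq ((toLex_lt_add_single s i).trans_le hut)
    (by omega)
  refine mem_upShadow.2 ⟨ht1, v, h.2 s hs v (mem_box.2 ⟨fun l => ?_, ?_⟩) hv, j, rfl⟩
  · exact lt_of_le_of_lt (by simp) (ht1 l)
  · rw [sum_add_single] at ht2
    omega

end IsLexUpper

lemma exists_isLexUpper {n : ℕ} (a : Fin n → ℕ) (d k : ℕ) (hk : k ≤ #(box a d)) :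
    ∃ L, IsLexUpper a d L ∧ #L = k := by
  induction k with
  | zero => exact ⟨∅, ⟨by simp, by simp⟩, rfl⟩
  | succ k ih =>
    obtain ⟨L, hL, hLk⟩ := ih (by omega)
    have hne : (box a d \ L).Nonempty := by
      rw [← card_pos, card_sdiff_of_subset hL.1]
      omega
    obtain ⟨m, hm, hmax⟩ := exists_max_image _ (fun u => toLex u) hne
    rw [mem_sdiff] at hm
    refine ⟨insert m L, ⟨insert_subset hm.1 hL.1, fun s hs t ht hst => ?_⟩, ?_⟩
    · rw [mem_insert] at hs ⊢
      by_contra! hc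
      rcases hs with rfl | hs
      · exact hc.1 (toLex.injective (le_antisymm (hmax t (mem_sdiff.2 ⟨ht, hc.2⟩)) hst))
      · exact hc.2 (hL.2 s hs t ht hst)
    · rw [card_insert_of_notMem hm.2, hLk]

/-- A lexicographically upper set of the given cardinality, when there is one. -/
noncomputable def lexUpper {n : ℕ} (a : Fin n → ℕ) (d k : ℕ) : Finset (Fin n → ℕ) :=
  if h : k ≤ #(box a d) then (exists_isLexUpper a d k h).choose else ∅

lemma isLexUpper_lexUpper {n : ℕ} {a : Fin n → ℕ} {d k : ℕ} (h : k ≤ #(box a d)) :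
    IsLexUpper a d (lexUpper a d k) := by
  rw [lexUpper, dif_pos h]
  exact (exists_isLexUpper a d k h).choose_spec.1

lemma card_lexUpper {n : ℕ} {a : Fin n → ℕ} {d k : ℕ} (h : k ≤ #(box a d)) :
    #(lexUpper a d k) = k := by
  rw [lexUpper, dif_pos h]
  exact (exists_isLexUpper a d k h).choose_spec.2

/-- The slice `x_k = b` of `S`, with the `k`-th coordinate removed. -/
def slice {n : ℕ} (S : Finset (Fin (n + 1) → ℕ)) (k : Fin (n + 1)) (b : ℕ) :
    Finset (Fin n → ℕ) :=
  {s ∈ S | s k = b}.image k.removeNth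

lemma mem_slice {n : ℕ} {S : Finset (Fin (n + 1) → ℕ)} {k : Fin (n + 1)} {b : ℕ}
    {t : Fin n → ℕ} : t ∈ slice S k b ↔ k.insertNth b t ∈ S := by
  simp only [slice, mem_image, mem_filter]
  constructor
  · rintro ⟨s, ⟨hs, rfl⟩, rfl⟩
    simpa using hs
  · intro h
    exact ⟨_, ⟨h, by simp⟩, by simp⟩

lemma sum_slice {n : ℕ} {S : Finset (Fin (n + 1) → ℕ)} {k : Fin (n + 1)} {b : ℕ}
    (f : (Fin (n + 1) → ℕ) → ℕ) :
    ∑ t ∈ slice S k b, f (k.insertNth b t) = ∑ s ∈ S with s k = b, f s := by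
  rw [slice, sum_image]
  · refine sum_congr rfl fun s hs => ?_
    rw [← (mem_filter.1 hs).2]
    simp
  · intro s hs t ht h
    rw [← Fin.insertNth_self_removeNth k s, ← Fin.insertNth_self_removeNth k t, h,
      (mem_filter.1 hs).2, (mem_filter.1 ht).2]

lemma card_slice {n : ℕ} {S : Finset (Fin (n + 1) → ℕ)} {k : Fin (n + 1)} {b : ℕ} :
    #(slice S k b) = #{s ∈ S | s k = b} := by
  simpa using sum_slice (S := S) (k := k) (b := b) fun _ => 1

lemma sum_eq_sum_slice {n : ℕ} {S : Finset (Fin (n + 1) → ℕ)} {k : Fin (n + 1)} {B : ℕ}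
    (hB : ∀ s ∈ S, s k < B) (f : (Fin (n + 1) → ℕ) → ℕ) :
    ∑ s ∈ S, f s = ∑ b ∈ range B, ∑ t ∈ slice S k b, f (k.insertNth b t) := by
  rw [← sum_fiberwise_of_maps_to (g := fun s => s k) (t := range B)]
  · exact sum_congr rfl fun b _ => (sum_slice f).symm
  · exact fun s hs => mem_range.2 (hB s hs)

lemma card_eq_sum_slice {n : ℕ} {S : Finset (Fin (n + 1) → ℕ)} {k : Fin (n + 1)} {B : ℕ}
    (hB : ∀ s ∈ S, s k < B) : #S = ∑ b ∈ range B, #(slice S k b) := by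
  simpa using sum_eq_sum_slice hB fun _ => 1

lemma insertNth_mem_box {n : ℕ} {a : Fin (n + 1) → ℕ} {d : ℕ} {k : Fin (n + 1)} {b : ℕ}
    {t : Fin n → ℕ} : k.insertNth b t ∈ box a d ↔
      b < a k ∧ b ≤ d ∧ t ∈ box (k.removeNth a) (d - b) := by
  rw [mem_box, mem_box, Fin.forall_iff_succAbove k, Fin.sum_univ_succAbove _ k]
  simp only [Fin.insertNth_apply_same, Fin.insertNth_apply_succAbove, Fin.removeNth]
  constructor
  · rintro ⟨⟨h1, h2⟩, h3⟩
    exact ⟨h1, by omega, h2, by omega⟩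
  · rintro ⟨h1, h2, h3, h4⟩
    exact ⟨⟨h1, h3⟩, by omega⟩

lemma slice_subset_box {n : ℕ} {a : Fin (n + 1) → ℕ} {d : ℕ} {S : Finset (Fin (n + 1) → ℕ)}
    (hS : S ⊆ box a d) (k : Fin (n + 1)) (b : ℕ) :
    slice S k b ⊆ box (k.removeNth a) (d - b) := fun _ ht =>
  (insertNth_mem_box.1 (hS (mem_slice.1 ht))).2.2

lemma slice_eq_empty {n : ℕ} {a : Fin (n + 1) → ℕ} {d : ℕ} {S : Finset (Fin (n + 1) → ℕ)}
    (hS : S ⊆ box a d) {k : Fin (n + 1)} {b : ℕ} (hb : a k ≤ b ∨ d < b) : slice S k b = ∅ := by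
  refine eq_empty_of_forall_notMem fun t ht => ?_
  have := insertNth_mem_box.1 (hS (mem_slice.1 ht))
  omega

lemma insertNth_add_single_same {n : ℕ} (k : Fin (n + 1)) (b : ℕ) (t : Fin n → ℕ) :
    (k.insertNth b t : Fin (n + 1) → ℕ) + Pi.single k 1 = k.insertNth (b + 1) t := by
  funext l
  cases l using Fin.succAboveCases k <;> simp

lemma insertNth_add_single_succAbove {n : ℕ} (k : Fin (n + 1)) (b : ℕ) (t : Fin n → ℕ)
    (i : Fin n) :
    (k.insertNth b t : Fin (n + 1) → ℕ) + Pi.single (k.succAbove i) 1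
      = k.insertNth b (t + Pi.single i 1) := by
  funext l
  cases l using Fin.succAboveCases k <;> simp [Pi.single_apply]

lemma mem_slice_upShadow {n : ℕ} {a : Fin (n + 1) → ℕ} {S : Finset (Fin (n + 1) → ℕ)}
    {k : Fin (n + 1)} {b : ℕ} {t : Fin n → ℕ} :
    t ∈ slice (upShadow a S) k b ↔ b < a k ∧ (t ∈ upShadow (k.removeNth a) (slice S k b) ∨
      (∀ i, t i < k.removeNth a i) ∧ ∃ b', b = b' + 1 ∧ t ∈ slice S k b') := by
  rw [mem_slice, mem_upShadow, Fin.forall_iff_succAbove k, mem_upShadow]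
  simp only [Fin.insertNth_apply_same, Fin.insertNth_apply_succAbove, Fin.removeNth]
  rw [and_assoc, ← and_or_left]
  refine and_congr_right fun _ => and_congr_right fun _ => ?_
  constructor
  · rintro ⟨s, hs, i, hi⟩
    rw [← Fin.insertNth_self_removeNth k s] at hs hi
    cases i using Fin.succAboveCases k with
    | x =>
      right
      rw [insertNth_add_single_same, Fin.insertNth_inj] at hi
      exact ⟨_, hi.1, mem_slice.2 (hi.2 ▸ hs)⟩
    | p i =>
      left
      rw [insertNth_add_single_succAbove, Fin.insertNth_inj] at hi
      exact ⟨_, mem_slice.2 (hi.1 ▸ hs), i, hi.2⟩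
  · rintro (⟨s, hs, i, rfl⟩ | ⟨b', rfl, h⟩)
    · exact ⟨_, mem_slice.1 hs, _, (insertNth_add_single_succAbove k b s i).symm⟩
    · exact ⟨_, mem_slice.1 h, _, (insertNth_add_single_same k b' t).symm⟩

lemma insertNth_lex_strictMono {n : ℕ} (k : Fin (n + 1)) (b : ℕ) {t t' : Fin n → ℕ}
    (h : toLex t < toLex t') :
    toLex (k.insertNth b t : Fin (n + 1) → ℕ) < toLex (k.insertNth b t' : Fin (n + 1) → ℕ) := by
  obtain ⟨i, hi, hlt⟩ := toLex_lt_iff.1 h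
  refine toLex_lt_iff.2 ⟨k.succAbove i, fun j hj => ?_, by simpa using hlt⟩
  cases j using Fin.succAboveCases k with
  | x => simp
  | p j => simpa using hi j (by simpa using hj)

lemma insertNth_lex_le_iff {n : ℕ} (k : Fin (n + 1)) (b : ℕ) {t t' : Fin n → ℕ} :
    toLex (k.insertNth b t : Fin (n + 1) → ℕ) ≤ toLex (k.insertNth b t' : Fin (n + 1) → ℕ) ↔
      toLex t ≤ toLex t' := by
  constructor
  · intro h
    by_contra! hc
    exact absurd (insertNth_lex_strictMono k b hc) (not_lt.2 h)
  · intro h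
    rcases h.eq_or_lt with h | h
    · rw [toLex.injective h]
    · exact (insertNth_lex_strictMono k b h).le

lemma card_slice_le {n : ℕ} {a : Fin (n + 1) → ℕ} {d : ℕ} {S : Finset (Fin (n + 1) → ℕ)}
    (hS : S ⊆ box a d) (k : Fin (n + 1)) (b : ℕ) :
    #(slice S k b) ≤ #(box (k.removeNth a) (d - b)) :=
  card_le_card (slice_subset_box hS k b)

/-- Replace every slice of `S` in direction `k` by the lexicographically upper set of the same
size. -/
noncomputable def compress {n : ℕ} (a : Fin (n + 1) → ℕ) (d : ℕ) (k : Fin (n + 1))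
    (S : Finset (Fin (n + 1) → ℕ)) : Finset (Fin (n + 1) → ℕ) :=
  {s ∈ box a d | k.removeNth s ∈ lexUpper (k.removeNth a) (d - s k) #(slice S k (s k))}

section Compress

variable {n : ℕ} {a : Fin (n + 1) → ℕ} {d : ℕ} {S : Finset (Fin (n + 1) → ℕ)}

lemma compress_subset_box (k : Fin (n + 1)) : compress a d k S ⊆ box a d := filter_subset _ _

lemma slice_compress (hS : S ⊆ box a d) (k : Fin (n + 1)) (b : ℕ) :
    slice (compress a d k S) k b = lexUpper (k.removeNth a) (d - b) #(slice S k b) := by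
  by_cases hb : a k ≤ b ∨ d < b
  · rw [slice_eq_empty (compress_subset_box k) hb, slice_eq_empty hS hb, eq_comm, ← card_eq_zero,
      card_empty, card_lexUpper (Nat.zero_le _)]
  · have hL := isLexUpper_lexUpper (card_slice_le hS k b)
    ext t
    rw [mem_slice, compress, mem_filter, insertNth_mem_box]
    simp only [Fin.insertNth_apply_same, Fin.removeNth_insertNth]
    refine ⟨fun h => h.2, fun h => ⟨⟨by omega, by omega, hL.1 h⟩, h⟩⟩

lemma card_slice_compress (hS : S ⊆ box a d) (k : Fin (n + 1)) (b : ℕ) :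
    #(slice (compress a d k S) k b) = #(slice S k b) := by
  rw [slice_compress hS, card_lexUpper (card_slice_le hS k b)]

lemma isLexUpper_slice_compress (hS : S ⊆ box a d) (k : Fin (n + 1)) (b : ℕ) :
    IsLexUpper (k.removeNth a) (d - b) (slice (compress a d k S) k b) := by
  rw [slice_compress hS]
  exact isLexUpper_lexUpper (card_slice_le hS k b)

lemma card_compress (hS : S ⊆ box a d) (k : Fin (n + 1)) : #(compress a d k S) = #S := by
  rw [card_eq_sum_slice (k := k) (B := a k) fun s hs => (mem_box.1 (compress_subset_box k hs)).1 k,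
    card_eq_sum_slice (k := k) (B := a k) fun s hs => (mem_box.1 (hS hs)).1 k]
  exact sum_congr rfl fun b _ => card_slice_compress hS k b

lemma card_upShadow_compress_le (hS : S ⊆ box a d) (k : Fin (n + 1))
    (ih : ∀ e, ∀ T ⊆ box (k.removeNth a) e, ∀ L, IsLexUpper (k.removeNth a) e L → #L ≤ #T →
      #(upShadow (k.removeNth a) L) ≤ #(upShadow (k.removeNth a) T)) :
    #(upShadow a (compress a d k S)) ≤ #(upShadow a S) := by
  rw [card_eq_sum_slice (k := k) (B := a k) fun s hs => (mem_upShadow.1 hs).1 k,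
    card_eq_sum_slice (k := k) (B := a k) fun s hs => (mem_upShadow.1 hs).1 k]
  refine sum_le_sum fun b hb => ?_
  rw [mem_range] at hb
  have hsub (b : ℕ) : slice S k b ⊆ box (k.removeNth a) (d - b) := slice_subset_box hS k b
  have hlex (b : ℕ) := isLexUpper_slice_compress hS k b
  have hup (T : Finset (Fin (n + 1) → ℕ)) :
      upShadow (k.removeNth a) (slice T k b) ⊆ slice (upShadow a T) k b := fun t ht =>
    mem_slice_upShadow.2 ⟨hb, Or.inl ht⟩
  have hle : #(upShadow (k.removeNth a) (slice (compress a d k S) k b)) ≤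
      #(slice (upShadow a S) k b) :=
    (ih _ _ (hsub b) _ (hlex b) (card_slice_compress hS k b).le).trans (card_le_card (hup S))
  cases b with
  | zero =>
    refine le_trans (card_le_card fun t ht => ?_) hle
    obtain ⟨-, h | ⟨-, b', hb', -⟩⟩ := mem_slice_upShadow.1 ht
    · exact h
    · omega
  | succ b =>
    have hsplit : slice (upShadow a (compress a d k S)) k (b + 1) ⊆
        upShadow (k.removeNth a) (slice (compress a d k S) k (b + 1)) ∪
          slice (compress a d k S) k b := by
      intro t ht
      obtain ⟨-, h | ⟨-, b', hb', h⟩⟩ := mem_slice_upShadow.1 ht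
      · exact mem_union_left _ h
      · obtain rfl : b = b' := by omega
        exact mem_union_right _ h
    have hle' : #(slice (compress a d k S) k b) ≤ #(slice (upShadow a S) k (b + 1)) := by
      rw [card_slice_compress hS]
      exact card_le_card fun t ht => mem_slice_upShadow.2
        ⟨hb, Or.inr ⟨(mem_box.1 (hsub b ht)).1, b, rfl, ht⟩⟩
    by_cases hbd : d < b + 1
    · rw [slice_eq_empty (compress_subset_box k) (Or.inr hbd)] at hsplit
      refine le_trans (card_le_card (hsplit.trans fun t ht => ?_)) hle'
      simpa [upShadow] using ht
    · have h1 := (hlex (b + 1)).upShadow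
      rw [show d - (b + 1) + 1 = d - b by omega] at h1
      rcases h1.total (hlex b) with h | h
      · exact (card_le_card (hsplit.trans (union_eq_right.2 h).subset)).trans hle'
      · exact (card_le_card (hsplit.trans (union_eq_left.2 h).subset)).trans hle

end Compress

/-- Among sets of equal size, lexicographically upper sets maximize the sum of a strictly
increasing weight. -/
lemma IsLexUpper.sum_lt_sum {n : ℕ} {a : Fin n → ℕ} {d : ℕ} {L T : Finset (Fin n → ℕ)}
    (hL : IsLexUpper a d L) (hT : T ⊆ box a d) (hc : #T = #L) (hne : T ≠ L)
    {f : (Fin n → ℕ) → ℕ}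
    (hf : ∀ u ∈ box a d, ∀ v ∈ box a d, toLex u < toLex v → f u < f v) :
    ∑ u ∈ T, f u < ∑ u ∈ L, f u := by
  have hcard : #(T \ L) = #(L \ T) := by
    have h1 := card_sdiff_add_card_inter T L
    have h2 := card_sdiff_add_card_inter L T
    rw [inter_comm] at h2
    omega
  have hTL : (T \ L).Nonempty := by
    rw [sdiff_nonempty]
    exact fun h => hne (eq_of_subset_of_card_le h hc.ge)
  have hLT : (L \ T).Nonempty := by rwa [← card_pos, ← hcard, card_pos]
  obtain ⟨m, hm, hmin⟩ := exists_min_image _ f hLT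
  have hlt : ∀ t ∈ T \ L, f t < f m := by
    intro t ht
    rw [mem_sdiff] at ht hm
    refine hf t (hT ht.1) m (hL.1 hm.1) ?_
    by_contra hc
    exact ht.2 (hL.2 m hm.1 t (hT ht.1) (not_lt.1 hc))
  have h1 : ∑ u ∈ T \ L, f u < ∑ u ∈ L \ T, f u :=
    calc ∑ u ∈ T \ L, f u < ∑ _u ∈ T \ L, f m := sum_lt_sum_of_nonempty hTL hlt
      _ = #(L \ T) * f m := by rw [sum_const, hcard, smul_eq_mul]
      _ ≤ ∑ u ∈ L \ T, f u := by simpa using card_nsmul_le_sum _ _ _ hmin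
  rw [← sum_sdiff (inter_subset_left : T ∩ L ⊆ T), ← sum_sdiff (inter_subset_right : T ∩ L ⊆ L),
    sdiff_inter_self_left, sdiff_inter_self_right]
  exact Nat.add_lt_add_right h1 _

open Classical in
/-- The number of elements of the box which are lexicographically smaller than `u`. -/
noncomputable def lexRank {n : ℕ} (a : Fin n → ℕ) (d : ℕ) (u : Fin n → ℕ) : ℕ :=
  #{v ∈ box a d | toLex v < toLex u}

lemma lexRank_lt_lexRank {n : ℕ} {a : Fin n → ℕ} {d : ℕ} {u v : Fin n → ℕ} (hu : u ∈ box a d)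
    (h : toLex u < toLex v) : lexRank a d u < lexRank a d v := by
  classical
  refine card_lt_card (ssubset_iff_of_subset (fun w hw => ?_) |>.2 ⟨u, ?_, ?_⟩)
  · rw [mem_filter] at hw ⊢
    exact ⟨hw.1, hw.2.trans h⟩
  · exact mem_filter.2 ⟨hu, h⟩
  · exact fun h => lt_irrefl _ (mem_filter.1 h).2

lemma sum_lexRank_lt_compress {n : ℕ} {a : Fin (n + 1) → ℕ} {d : ℕ}
    {S : Finset (Fin (n + 1) → ℕ)} (hS : S ⊆ box a d) {k : Fin (n + 1)} {b : ℕ}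
    (hne : ¬ IsLexUpper (k.removeNth a) (d - b) (slice S k b)) :
    ∑ s ∈ S, lexRank a d s < ∑ s ∈ compress a d k S, lexRank a d s := by
  rw [sum_eq_sum_slice (k := k) (B := a k) fun s hs => (mem_box.1 (hS hs)).1 k,
    sum_eq_sum_slice (k := k) (B := a k) fun s hs => (mem_box.1 (compress_subset_box k hs)).1 k]
  have hne' (b : ℕ) (h : slice S k b ≠ slice (compress a d k S) k b) :
      ∑ t ∈ slice S k b, lexRank a d (k.insertNth b t) <
        ∑ t ∈ slice (compress a d k S) k b, lexRank a d (k.insertNth b t) := by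
    have hb : ¬ (a k ≤ b ∨ d < b) := by
      intro hb
      rw [slice_eq_empty hS hb, slice_eq_empty (compress_subset_box k) hb] at h
      exact h rfl
    refine (isLexUpper_slice_compress hS k b).sum_lt_sum (f := fun t => lexRank a d _)
      (slice_subset_box hS k b) (card_slice_compress hS k b).symm h fun u hu v _ huv => ?_
    refine lexRank_lt_lexRank (insertNth_mem_box.2 ⟨by omega, by omega, hu⟩)
      (insertNth_lex_strictMono k b huv)
  have hb : slice S k b ≠ slice (compress a d k S) k b := by
    intro h
    exact hne (h ▸ isLexUpper_slice_compress hS k b)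
  refine sum_lt_sum (fun b' _ => ?_) ⟨b, ?_, hne' b hb⟩
  · by_cases h : slice S k b' = slice (compress a d k S) k b'
    · rw [h]
    · exact (hne' b' h).le
  · rw [mem_range]
    by_contra! hab
    rw [slice_eq_empty hS (Or.inl hab), slice_eq_empty (compress_subset_box k) (Or.inl hab)] at hb
    exact hb rfl

/-- `S` is stable under replacing a variable by an earlier one, inside the box. -/
def IsStable {n : ℕ} (a : Fin n → ℕ) (S : Finset (Fin n → ℕ)) : Prop :=
  ∀ s ∈ S, ∀ t : Fin n → ℕ, (∀ l, t l < a l) → ∀ i j : Fin n, i ≤ j →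
    t + Pi.single j 1 = s + Pi.single i 1 → t ∈ S

lemma toLex_le_of_add_single_eq {n : ℕ} {s t : Fin n → ℕ} {i j : Fin n} (hij : i ≤ j)
    (h : t + Pi.single j 1 = s + Pi.single i 1) : toLex s ≤ toLex t := by
  rcases hij.eq_or_lt with rfl | hij
  · rw [add_right_cancel h]
  · refine le_of_lt (toLex_lt_iff.2 ⟨i, fun l hl => ?_, ?_⟩)
    · simpa [hl.ne, (hl.trans hij).ne] using (congrFun h l).symm
    · have := congrFun h i
      simp [hij.ne] at this
      omega

lemma sum_eq_of_add_single_eq {n : ℕ} {s t : Fin n → ℕ} {i j : Fin n}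
    (h : t + Pi.single j 1 = s + Pi.single i 1) : ∑ l, t l = ∑ l, s l := by
  have h1 := sum_add_single t j
  rw [h, sum_add_single] at h1
  omega

lemma IsLexUpper.isStable {n : ℕ} {a : Fin n → ℕ} {d : ℕ} {L : Finset (Fin n → ℕ)}
    (hL : IsLexUpper a d L) : IsStable a L := fun s hs t ht _ _ hij h =>
  hL.2 s hs t (mem_box.2 ⟨ht, (sum_eq_of_add_single_eq h).trans (mem_box.1 (hL.1 hs)).2⟩)
    (toLex_le_of_add_single_eq hij h)

lemma card_upShadow_of_isStable {n : ℕ} {a : Fin (n + 1) → ℕ} {S : Finset (Fin (n + 1) → ℕ)}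
    (hS : IsStable a S) (ha : ∀ s ∈ S, ∀ i, s i < a i) :
    #(upShadow a S) = #(upShadow ((Fin.last n).removeNth a) (slice S (Fin.last n) 0)) +
      #{s ∈ S | s (Fin.last n) + 1 < a (Fin.last n)} := by
  by_cases h0 : 0 < a (Fin.last n)
  swap
  · have : S = ∅ := eq_empty_of_forall_notMem fun s hs => h0 (Nat.zero_lt_of_lt (ha s hs _))
    subst this
    simp [upShadow, slice]
  rw [← card_filter_add_card_filter_not (s := upShadow a S) (fun u => u (Fin.last n) = 0),
    ← card_slice]
  congr 1
  · congr 1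
    ext t
    rw [mem_slice_upShadow]
    simp [h0]
  · symm
    refine card_nbij (fun s => s + Pi.single (Fin.last n) 1) ?_ ?_ ?_
    · intro s hs
      simp only [coe_filter, Set.mem_ofPred_eq] at hs ⊢
      refine ⟨mem_upShadow.2 ⟨fun l => ?_, s, hs.1, _, rfl⟩, by simp⟩
      by_cases hl : l = Fin.last n
      · subst hl; simpa using hs.2
      · simpa [hl] using ha s hs.1 l
    · exact fun s _ t _ h => add_right_cancel h
    · intro u hu
      simp only [coe_filter, Set.mem_ofPred_eq] at hu
      obtain ⟨hu1, s, hs, i, hi⟩ := mem_upShadow.1 hu.1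
      have hu' : (u - Pi.single (Fin.last n) 1) + Pi.single (Fin.last n) 1 = u :=
        sub_single_add_single (by omega)
      refine ⟨u - Pi.single (Fin.last n) 1, ?_, hu'⟩
      simp only [coe_filter, Set.mem_ofPred_eq]
      refine ⟨hS s hs _ (fun l => ?_) i _ (Fin.le_last i) (hu'.trans hi), ?_⟩
      · exact lt_of_le_of_lt (by simp) (hu1 l)
      · have := hu1 (Fin.last n)
        simp
        omega

section Move

variable {n : ℕ} {a : Fin (n + 1) → ℕ}

lemma exists_shift {n : ℕ} {s : Fin n → ℕ} {i j : Fin n} (hij : i ≠ j) (hj : 0 < s j) :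
    ∃ t : Fin n → ℕ, t + Pi.single j 1 = s + Pi.single i 1 ∧ t i = s i + 1 ∧ t j = s j - 1 ∧
      ∀ l, l ≠ i → l ≠ j → t l = s l := by
  refine ⟨s + Pi.single i 1 - Pi.single j 1, ?_, ?_, ?_, ?_⟩
  · funext l
    by_cases hl : l = j
    · subst hl; simp [hij.symm]; omega
    · simp [hl]
  · simp [hij]
  · simp [hij.symm]
  · intro l h1 h2
    simp [h1, h2]

/-- If `s < w` with `w` free of the last variable, then one can replace the last variable by an
earlier one in `s` without exceeding `w`. -/
lemma exists_shift_le {s w : Fin (n + 1) → ℕ} (hsum : ∑ l, s l = ∑ l, w l)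
    (hs : ∀ l, s l < a l) (hw : ∀ l, w l < a l) (hw0 : w (Fin.last n) = 0)
    (hs0 : 0 < s (Fin.last n)) (hlt : toLex s < toLex w) :
    ∃ t : Fin (n + 1) → ℕ, ∃ i, t + Pi.single (Fin.last n) 1 = s + Pi.single i 1 ∧
      (∀ l, t l < a l) ∧ toLex t ≤ toLex w ∧ t (Fin.last n) < s (Fin.last n) := by
  obtain ⟨i, hi, hlti⟩ := toLex_lt_iff.1 hlt
  have hil : i ≠ Fin.last n := by rintro rfl; omega
  have hbox {j : Fin (n + 1)} {t : Fin (n + 1) → ℕ} (hj : s j + 1 < a j) (h1 : t j = s j + 1)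
      (h2 : t (Fin.last n) = s (Fin.last n) - 1)
      (h3 : ∀ l, l ≠ j → l ≠ Fin.last n → t l = s l) (l) : t l < a l := by
    by_cases hlj : l = j
    · subst hlj; omega
    by_cases hll : l = Fin.last n
    · subst hll; have := hs (Fin.last n); omega
    · rw [h3 l hlj hll]; exact hs l
  by_cases h : ∃ j, i < j ∧ j ≠ Fin.last n ∧ s j + 1 < a j
  · obtain ⟨j, hij, hjl, hj⟩ := h
    obtain ⟨t, ht, h1, h2, h3⟩ := exists_shift hjl hs0
    refine ⟨t, j, ht, hbox hj h1 h2 h3, le_of_lt (toLex_lt_iff.2 ⟨i, fun l hl => ?_, ?_⟩), by omega⟩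
    · rw [h3 l (hl.trans hij).ne (hl.trans_le (Fin.le_last i)).ne, hi l hl]
    · rwa [h3 i hij.ne hil]
  · push Not at h
    obtain ⟨t, ht, h1, h2, h3⟩ := exists_shift hil hs0
    have hi' : s i + 1 < a i := lt_of_le_of_lt hlti (hw i)
    refine ⟨t, i, ht, hbox hi' h1 h2 h3, ?_, by omega⟩
    have hpre : ∀ l, l < i → t l = w l := fun l hl => by
      rw [h3 l hl.ne (hl.trans_le (Fin.le_last i)).ne, hi l hl]
    by_cases hlt' : s i + 1 < w i
    · exact le_of_lt (toLex_lt_iff.2 ⟨i, hpre, by omega⟩)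
    · have : w = t := by
        refine eq_of_le_of_sum_eq (fun l => ?_) ?_
        · rcases lt_trichotomy l i with hl | rfl | hl
          · exact (hpre l hl).ge
          · omega
          · by_cases hll : l = Fin.last n
            · subst hll; omega
            · rw [h3 l hl.ne' hll]
              have := h l hl hll
              have := hw l
              omega
        · rw [sum_eq_of_add_single_eq ht, hsum]
      rw [this]

/-- If `w < u` and the last exponent of `u` is smaller than that of `w`, then one can replace
some variable of `u` by the last one and stay above `w`. -/
lemma exists_shift_ge {u w : Fin (n + 1) → ℕ} (hsum : ∑ l, u l = ∑ l, w l)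
    (hu : ∀ l, u l < a l) (hw : ∀ l, w l < a l)
    (hul : u (Fin.last n) < w (Fin.last n)) (hlt : toLex w < toLex u) :
    ∃ t : Fin (n + 1) → ℕ, ∃ i, u + Pi.single (Fin.last n) 1 = t + Pi.single i 1 ∧
      (∀ l, t l < a l) ∧ toLex w ≤ toLex t ∧ t (Fin.last n) = u (Fin.last n) + 1 := by
  obtain ⟨i, hi, hlti⟩ := toLex_lt_iff.1 hlt
  have hil : i ≠ Fin.last n := by rintro rfl; omega
  have hbox {j : Fin (n + 1)} {t : Fin (n + 1) → ℕ} (h2 : t j = u j - 1)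
      (h1 : t (Fin.last n) = u (Fin.last n) + 1)
      (h3 : ∀ l, l ≠ Fin.last n → l ≠ j → t l = u l) (l) : t l < a l := by
    by_cases hll : l = Fin.last n
    · subst hll; have := hw (Fin.last n); omega
    by_cases hlj : l = j
    · subst hlj; have := hu l; omega
    · rw [h3 l hll hlj]; exact hu l
  by_cases h : ∃ j, i < j ∧ j ≠ Fin.last n ∧ 0 < u j
  · obtain ⟨j, hij, hjl, hj⟩ := h
    obtain ⟨t, ht, h1, h2, h3⟩ := exists_shift hjl.symm hj
    refine ⟨t, j, ht.symm, hbox h2 h1 h3,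
      le_of_lt (toLex_lt_iff.2 ⟨i, fun l hl => ?_, ?_⟩), h1⟩
    · rw [h3 l (hl.trans_le (Fin.le_last i)).ne (hl.trans hij).ne, hi l hl]
    · rwa [h3 i hil hij.ne]
  · push Not at h
    obtain ⟨t, ht, h1, h2, h3⟩ := exists_shift hil.symm (by omega : 0 < u i)
    refine ⟨t, i, ht.symm, hbox h2 h1 h3, ?_, h1⟩
    have hpre : ∀ l, l < i → w l = t l := fun l hl => by
      rw [h3 l (hl.trans_le (Fin.le_last i)).ne hl.ne, hi l hl]
    by_cases hlt' : w i < u i - 1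
    · exact le_of_lt (toLex_lt_iff.2 ⟨i, hpre, by omega⟩)
    · have : t = w := by
        refine eq_of_le_of_sum_eq (fun l => ?_) ?_
        · rcases lt_trichotomy l i with hl | rfl | hl
          · exact (hpre l hl).ge
          · omega
          · by_cases hll : l = Fin.last n
            · subst hll; omega
            · rw [h3 l hll hl.ne']
              have := h l hl hll
              omega
        · rw [sum_eq_of_add_single_eq ht, hsum]
      rw [this]

end Move

section Stable

variable {n : ℕ} {a : Fin (n + 1) → ℕ} {d : ℕ} {S L : Finset (Fin (n + 1) → ℕ)}

/-- A stable set all of whose elements with last exponent `0` form a lexicographically upper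
set contains at least as many of those as the lexicographically upper set of its size. -/
lemma subset_of_last_eq_zero (hS : S ⊆ box a d) (hst : IsStable a S)
    (hlex : ∀ s ∈ S, ∀ t ∈ box a d, s (Fin.last n) = t (Fin.last n) → toLex s ≤ toLex t → t ∈ S)
    (hL : IsLexUpper a d L) (hc : #L ≤ #S) :
    {s ∈ L | s (Fin.last n) = 0} ⊆ {s ∈ S | s (Fin.last n) = 0} := by
  intro w hw
  rw [mem_filter] at hw ⊢
  refine ⟨?_, hw.2⟩
  by_contra hwS
  obtain ⟨hw1, hw2⟩ := mem_box.1 (hL.1 hw.1)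
  have hmain : ∀ b, ∀ s ∈ S, s (Fin.last n) = b → toLex w < toLex s := by
    intro b
    induction b with
    | zero =>
      intro s hs hb
      by_contra hle
      exact hwS (hlex s hs w (hL.1 hw.1) (hb.trans hw.2.symm) (not_lt.1 hle))
    | succ b ih =>
      intro s hs hb
      by_contra hle
      rcases (not_lt.1 hle).eq_or_lt with heq | hlt
      · exact hwS (toLex.injective heq ▸ hs)
      obtain ⟨hs1, hs2⟩ := mem_box.1 (hS hs)
      obtain ⟨t, i, ht, hta, htw, htl⟩ := exists_shift_le (hs2.trans hw2.symm) hs1 hw1 hw.2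
        (by omega) hlt
      have hil : i ≠ Fin.last n := by
        rintro rfl
        rw [add_right_cancel ht] at htl
        omega
      have htb : t (Fin.last n) = b := by
        have := congrFun ht (Fin.last n)
        simp [hil.symm] at this
        omega
      exact absurd (ih t (hst s hs t hta i _ (Fin.le_last i) ht) htb) (not_lt.2 htw)
  have hSL : S ⊂ L := by
    refine (ssubset_iff_of_subset fun s hs => ?_).2 ⟨w, hw.1, hwS⟩
    exact hL.2 w hw.1 s (hS hs) (hmain _ s hs rfl).le
  exact absurd (card_lt_card hSL) (not_lt.2 hc)

lemma subset_of_last_eq_max (hS : S ⊆ box a d) (hst : IsStable a S)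
    (hlex : ∀ s ∈ S, ∀ t ∈ box a d, s (Fin.last n) = t (Fin.last n) → toLex s ≤ toLex t → t ∈ S)
    (hL : IsLexUpper a d L) (hc : #S ≤ #L) :
    {s ∈ S | ¬ s (Fin.last n) + 1 < a (Fin.last n)} ⊆
      {s ∈ L | ¬ s (Fin.last n) + 1 < a (Fin.last n)} := by
  intro w hw
  rw [mem_filter] at hw ⊢
  refine ⟨?_, hw.2⟩
  by_contra hwL
  obtain ⟨hw1, hw2⟩ := mem_box.1 (hS hw.1)
  have hmain : ∀ b, ∀ u ∈ box a d, w (Fin.last n) - u (Fin.last n) = b → toLex w ≤ toLex u →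
      u ∈ S := by
    intro b
    induction b with
    | zero =>
      intro u hu hb hle
      have := (mem_box.1 hu).1 (Fin.last n)
      exact hlex w hw.1 u hu (by omega) hle
    | succ b ih =>
      intro u hu hb hle
      rcases hle.eq_or_lt with heq | hlt
      · exact toLex.injective heq ▸ hw.1
      obtain ⟨hu1, hu2⟩ := mem_box.1 hu
      obtain ⟨t, i, ht, hta, htw, htl⟩ := exists_shift_ge (hu2.trans hw2.symm) hu1 hw1
        (by omega) hlt
      have htS : t ∈ S := ih t (mem_box.2 ⟨hta, (sum_eq_of_add_single_eq ht).symm.trans hu2⟩)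
        (by omega) htw
      exact hst t htS u hu1 i _ (Fin.le_last i) ht
  have hLS : L ⊂ S := by
    refine (ssubset_iff_of_subset fun s hs => ?_).2 ⟨w, hw.1, hwL⟩
    refine hmain _ s (hL.1 hs) rfl ?_
    by_contra hle
    exact hwL (hL.2 s hs w (hS hw.1) (not_le.1 hle).le)
  exact absurd (card_lt_card hLS) (not_lt.2 hc)

lemma card_upShadow_le_of_isStable (hS : S ⊆ box a d) (hst : IsStable a S)
    (hlex : ∀ s ∈ S, ∀ t ∈ box a d, s (Fin.last n) = t (Fin.last n) → toLex s ≤ toLex t → t ∈ S)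
    (hL : IsLexUpper a d L) (hc : #L = #S) : #(upShadow a L) ≤ #(upShadow a S) := by
  rw [card_upShadow_of_isStable hst fun s hs => (mem_box.1 (hS hs)).1,
    card_upShadow_of_isStable hL.isStable fun s hs => (mem_box.1 (hL.1 hs)).1]
  refine add_le_add (card_le_card (upShadow_mono ?_)) ?_
  · exact image_subset_image (subset_of_last_eq_zero hS hst hlex hL hc.le)
  · have h1 := card_le_card (subset_of_last_eq_max hS hst hlex hL hc.ge)
    have h2 := card_filter_add_card_filter_not (s := S)
      (fun s => s (Fin.last n) + 1 < a (Fin.last n))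
    have h3 := card_filter_add_card_filter_not (s := L)
      (fun s => s (Fin.last n) + 1 < a (Fin.last n))
    omega

end Stable

lemma card_box_le_one {n : ℕ} (hn : n ≤ 1) (a : Fin n → ℕ) (d : ℕ) : #(box a d) ≤ 1 := by
  rw [card_le_one]
  intro u hu v hv
  have h := (mem_box.1 hu).2.trans (mem_box.1 hv).2.symm
  interval_cases n
  · exact Subsingleton.elim _ _
  · funext l
    simpa [Subsingleton.elim l 0] using h

lemma card_upShadow_le_of_two {a : Fin 2 → ℕ} (ha : a 0 ≤ a 1) {d : ℕ}
    {S L : Finset (Fin 2 → ℕ)} (hS : S ⊆ box a d) (hL : IsLexUpper a d L) (hc : #L = #S) :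
    #(upShadow a L) ≤ #(upShadow a S) := by
  by_cases hfull : S = box a d
  · have : L = S := eq_of_subset_of_card_le (hfull ▸ hL.1) hc.ge
    rw [this]
  have hmem {s : Fin 2 → ℕ} (hs : s ∈ box a d) : s 0 < a 0 ∧ s 1 < a 1 ∧ s 0 + s 1 = d := by
    simpa [mem_box, and_assoc] using hs
  have hext {s t : Fin 2 → ℕ} (hs : s ∈ box a d) (ht : t ∈ box a d) (h : s 0 = t 0) : s = t := by
    have h1 := hmem hs
    have h2 := hmem ht
    funext l
    fin_cases l
    · exact h
    · simp; omega
  have hbox0 := upShadow_subset_box (slice_subset_box hL.1 (Fin.last 1) 0)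
  have hup : #(upShadow a L) ≤
      #(upShadow ((Fin.last 1).removeNth a) (slice L (Fin.last 1) 0)) + #L := by
    rw [card_upShadow_of_isStable hL.isStable fun s hs => (mem_box.1 (hL.1 hs)).1]
    exact Nat.add_le_add_left (card_filter_le _ _) _
  by_cases hd : d + 1 < a 0
  · rcases S.eq_empty_or_nonempty with rfl | hne
    · have : L = ∅ := by simpa using hc
      rw [this]
    have h1 := (card_le_card hbox0).trans (card_box_le_one le_rfl _ _)
    obtain ⟨m, hm, hmax⟩ := exists_max_image S (fun s => s 0) hne
    have hnot : m + Pi.single 0 1 ∉ S.image fun s => s + Pi.single 1 1 := by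
      intro h
      obtain ⟨s, hs, hsm⟩ := mem_image.1 h
      have := hmax s hs
      have := congrFun hsm 0
      simp at this
      omega
    have hsub : insert (m + Pi.single 0 1) (S.image fun s => s + Pi.single 1 1) ⊆
        upShadow a S := by
      refine insert_subset (mem_upShadow.2 ⟨?_, m, hm, 0, rfl⟩) (image_subset_iff.2 fun s hs =>
        mem_upShadow.2 ⟨?_, s, hs, 1, rfl⟩)
      · have := hmem (hS hm)
        simp [Fin.forall_fin_two]
        omega
      · have := hmem (hS hs)
        simp [Fin.forall_fin_two]
        omega
    have h2 := card_le_card hsub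
    rw [card_insert_of_notMem hnot, card_image_of_injective _ (add_left_injective _)] at h2
    omega
  · have h1 : upShadow ((Fin.last 1).removeNth a) (slice L (Fin.last 1) 0) = ∅ := by
      refine eq_empty_of_forall_notMem fun t ht => ?_
      have := mem_box.1 (hbox0 ht)
      simp [Fin.removeNth, Fin.forall_fin_one] at this
      omega
    obtain ⟨q, hq, hqS⟩ : ∃ q ∈ box a d, q ∉ S := by
      by_contra! h
      exact hfull (hS.antisymm h)
    have hq' := hmem hq
    have h2 : #S ≤ #(upShadow a S) := by
      refine card_le_card_of_injOn
        (fun s => if s 0 < q 0 then s + Pi.single 0 1 else s + Pi.single 1 1) ?_ ?_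
      · intro s hs
        have h3 := hmem (hS hs)
        have h4 : s 0 ≠ q 0 := fun h => hqS (hext (hS hs) hq h ▸ hs)
        simp only [mem_coe]
        split_ifs with h
        · refine mem_upShadow.2 ⟨?_, s, hs, _, rfl⟩
          simp [Fin.forall_fin_two]
          omega
        · refine mem_upShadow.2 ⟨?_, s, hs, _, rfl⟩
          simp [Fin.forall_fin_two]
          omega
      · intro s hs t ht hst
        have h3 := hmem (hS hs)
        have h3' := hmem (hS ht)
        have h4 : s 0 ≠ q 0 := fun h => hqS (hext (hS hs) hq h ▸ hs)
        have h4' : t 0 ≠ q 0 := fun h => hqS (hext (hS ht) hq h ▸ ht)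
        refine hext (hS hs) (hS ht) ?_
        have h5 := congrFun hst 0
        simp only at h5
        split_ifs at h5 <;> simp at h5 <;> omega
    rw [h1, card_empty] at hup
    omega

lemma removeNth_monotone {n : ℕ} {a : Fin (n + 1) → ℕ} (ha : Monotone a) (k : Fin (n + 1)) :
    Monotone (k.removeNth a) := fun _ _ h => ha (k.strictMono_succAbove.monotone h)

/-- One step of the Clements–Lindström theorem: from `n + 2` to `n + 3` variables. -/
lemma card_upShadow_le_succ {n : ℕ} {a : Fin (n + 3) → ℕ}
    (ih : ∀ k : Fin (n + 3), ∀ e, ∀ T ⊆ box (k.removeNth a) e, ∀ L,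
      IsLexUpper (k.removeNth a) e L → #L ≤ #T →
        #(upShadow (k.removeNth a) L) ≤ #(upShadow (k.removeNth a) T))
    {d : ℕ} {S L : Finset (Fin (n + 3) → ℕ)} (hS : S ⊆ box a d) (hL : IsLexUpper a d L)
    (hc : #L = #S) : #(upShadow a L) ≤ #(upShadow a S) := by
  obtain ⟨T, hT, hmax⟩ := exists_max_image
    {T ∈ (box a d).powerset | #T = #S ∧ #(upShadow a T) ≤ #(upShadow a S)}
    (fun T => ∑ t ∈ T, lexRank a d t) ⟨S, by simp [hS]⟩
  simp only [mem_filter, mem_powerset] at hT hmax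
  obtain ⟨hTbox, hTc, hTS⟩ := hT
  refine le_trans ?_ hTS
  have hslice (k : Fin (n + 3)) (b : ℕ) : IsLexUpper (k.removeNth a) (d - b) (slice T k b) := by
    by_contra hne
    refine absurd (sum_lexRank_lt_compress hTbox hne) (not_lt.2 (hmax _ ⟨compress_subset_box k,
      (card_compress hTbox k).trans hTc, ?_⟩))
    exact (card_upShadow_compress_le hTbox k (ih k)).trans hTS
  have hlex (k : Fin (n + 3)) : ∀ s ∈ T, ∀ t ∈ box a d, s k = t k → toLex s ≤ toLex t →
      t ∈ T := by
    intro s hs t ht hk hst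
    rw [← Fin.insertNth_self_removeNth k s, hk] at hs hst
    rw [← Fin.insertNth_self_removeNth k t] at ht ⊢ hst
    simp only [Fin.insertNth_apply_same] at hs hst
    rw [insertNth_lex_le_iff] at hst
    exact mem_slice.1 ((hslice k (t k)).2 _ (mem_slice.2 hs) _ (insertNth_mem_box.1 ht).2.2 hst)
  refine card_upShadow_le_of_isStable hTbox (fun s hs t ht i j hij h => ?_) (hlex _) hL
    (hc.trans hTc.symm)
  obtain ⟨k, hk⟩ : ∃ k, k ∉ ({i, j} : Finset (Fin (n + 3))) := by
    by_contra! hall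
    have h1 : #({i, j} : Finset (Fin (n + 3))) ≤ 2 := card_le_two
    rw [eq_univ_iff_forall.2 hall, card_univ, Fintype.card_fin] at h1
    omega
  simp only [mem_insert, mem_singleton, not_or] at hk
  refine hlex k s hs t (mem_box.2 ⟨ht, ?_⟩) ?_ (toLex_le_of_add_single_eq hij h)
  · rw [sum_eq_of_add_single_eq h, (mem_box.1 (hTbox hs)).2]
  · simpa [hk.1, hk.2] using (congrFun h k).symm

/-- The **Clements–Lindström theorem**: lexicographically upper sets have the smallest upper
shadows. -/
theorem card_upShadow_le {n : ℕ} {a : Fin n → ℕ} (ha : Monotone a) {d : ℕ}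
    {S L : Finset (Fin n → ℕ)} (hS : S ⊆ box a d) (hL : IsLexUpper a d L) (hc : #L ≤ #S) :
    #(upShadow a L) ≤ #(upShadow a S) := by
  induction n using Nat.strong_induction_on generalizing d with
  | _ n ih =>
    obtain ⟨T, hTS, hTc⟩ := exists_subset_card_eq hc
    refine le_trans ?_ (card_le_card (upShadow_mono hTS))
    replace hS := hTS.trans hS
    have hsmall (hn : n ≤ 1) : #(upShadow a L) ≤ #(upShadow a T) := by
      suffices L = T by rw [this]
      rcases L.eq_empty_or_nonempty with rfl | hne
      · exact (card_eq_zero.1 hTc).symm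
      · have h1 := (card_box_le_one hn a d).trans hne.card_pos
        rw [eq_of_subset_of_card_le hL.1 h1, eq_of_subset_of_card_le hS (hTc ▸ h1)]
    rcases n with _ | _ | _ | n
    · exact hsmall (by omega)
    · exact hsmall le_rfl
    · exact card_upShadow_le_of_two (ha (Fin.zero_le _)) hS hL hTc.symm
    · exact card_upShadow_le_succ (fun k e T' hT' L' hL' hc' => ih (n + 2) (by omega)
        (removeNth_monotone ha k) hT' hL' hc') hS hL hTc.symm

/-- The number of elements of the box supported on the last `h` coordinates. -/
def tailCard {n : ℕ} (a : Fin n → ℕ) (h d : ℕ) : ℕ :=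
  #{u ∈ box a d | ∀ i : Fin n, (i : ℕ) < n - h → u i = 0}

open Classical in
lemma lexRank_add_single {n : ℕ} {a : Fin n → ℕ} {m : Fin n → ℕ} {i : Fin n}
    (hm : ∀ j, j < i → m j = 0) (hi : m i + 1 < a i) (e : ℕ) :
    lexRank a (e + 1) (m + Pi.single i 1) =
      lexRank a e m + tailCard a (n - 1 - i) (e + 1) := by
  unfold lexRank
  have hzero {u : Fin n → ℕ} (hu : toLex u < toLex (m + Pi.single i 1)) (j) (hj : j < i) :
      u j = 0 := by
    obtain ⟨l, hl, hlt⟩ := toLex_lt_iff.1 hu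
    have hil : i ≤ l := by
      by_contra! hli
      simp [hm l hli, hli.ne] at hlt
    rw [hl j (hj.trans_le hil)]
    simp [hm j hj, hj.ne]
  have hlt_iff {u : Fin n → ℕ} : toLex (u + Pi.single i 1) < toLex (m + Pi.single i 1) ↔
      toLex u < toLex m := by
    simp [toLex_lt_iff]
  rw [← card_filter_add_card_filter_not (s := {u ∈ box a (e + 1) | _}) (fun u => u i = 0), add_comm]
  congr 1
  · symm
    refine card_nbij (fun s => s + Pi.single i 1) ?_ ?_ ?_
    · intro s hs
      simp only [coe_filter, Set.mem_ofPred_eq, mem_filter] at hs ⊢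
      obtain ⟨hs, hsm⟩ := hs
      obtain ⟨hs1, hs2⟩ := mem_box.1 hs
      refine ⟨⟨mem_box.2 ⟨fun l => ?_, ?_⟩, hlt_iff.2 hsm⟩, by simp⟩
      · by_cases hl : l = i
        · subst hl
          have : s l ≤ m l := by
            obtain ⟨j, hj, hlt⟩ := toLex_lt_iff.1 hsm
            rcases lt_trichotomy j l with h | rfl | h
            · rw [hm j h] at hlt
              omega
            · exact hlt.le
            · exact (hj l h).le
          simp
          omega
        · simpa [hl] using hs1 l
      · rw [sum_add_single, hs2]
    · exact fun s _ t _ h => add_right_cancel h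
    · intro u hu
      simp only [coe_filter, Set.mem_ofPred_eq, mem_filter] at hu
      obtain ⟨⟨hu, hum⟩, hui⟩ := hu
      obtain ⟨hu1, hu2⟩ := mem_box.1 hu
      have hu' : (u - Pi.single i 1) + Pi.single i 1 = u :=
        sub_single_add_single (by omega)
      refine ⟨u - Pi.single i 1, ?_, hu'⟩
      simp only [coe_filter, Set.mem_ofPred_eq]
      refine ⟨mem_box.2 ⟨fun l => lt_of_le_of_lt (by simp) (hu1 l), ?_⟩, ?_⟩
      · have := sum_add_single (u - Pi.single i 1) i
        rw [hu'] at this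
        omega
      · rwa [← hlt_iff, hu']
  · unfold tailCard
    congr 1
    ext u
    simp only [mem_filter]
    have hi := i.2
    constructor
    · rintro ⟨⟨h1, h2⟩, h3⟩
      refine ⟨h1, fun j hj => ?_⟩
      rcases eq_or_ne j i with rfl | hne
      · exact h3
      · exact hzero h2 j (lt_of_le_of_ne (Fin.le_def.2 (by omega)) hne)
    · rintro ⟨h1, h2⟩
      have h3 : u i = 0 := h2 i (by omega)
      refine ⟨⟨h1, toLex_lt_iff.2 ⟨i, fun j hj => ?_, ?_⟩⟩, h3⟩
      · rw [h2 j (by have := Fin.lt_def.1 hj; omega)]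
        simp [hm j hj, hj.ne]
      · simp [h3]

/-- The exponent vector encoded by a sequence `c 1 ≤ … ≤ c d` of numbers `< n`: the factors are
the variables with index `n - 1 - c t`. -/
def seqVec (n d : ℕ) (c : ℕ → ℕ) : Fin n → ℕ := fun i => #{t ∈ Icc 1 d | c t = n - 1 - i}

lemma seqVec_succ {n d : ℕ} {c : ℕ → ℕ} {i : Fin n} (hi : c (d + 1) = n - 1 - i) :
    seqVec n (d + 1) c = seqVec n d c + Pi.single i 1 := by
  funext j
  have hins : Icc 1 (d + 1) = insert (d + 1) (Icc 1 d) := by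
    ext t
    simp only [mem_Icc, mem_insert]
    omega
  simp only [seqVec, Pi.add_apply, hins, filter_insert, hi]
  have := j.2
  have := i.2
  by_cases hij : j = i
  · subst hij
    simp
  · rw [if_neg fun h => hij (Fin.ext (by omega))]
    simp [hij]

lemma sum_seqVec {n d : ℕ} {c : ℕ → ℕ} (hc : ∀ t ∈ Icc 1 d, c t < n) :
    ∑ i, seqVec n d c i = d := by
  induction d with
  | zero => simp [seqVec]
  | succ d ih =>
    have hd := hc (d + 1) (by simp)
    rw [seqVec_succ (i := ⟨n - 1 - c (d + 1), by omega⟩) (by simp; omega), sum_add_single, ih]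
    intro t ht
    rw [mem_Icc] at ht
    exact hc t (mem_Icc.2 (by omega))

lemma lexRank_seqVec {n d : ℕ} {a : Fin n → ℕ} {c : ℕ → ℕ} (hc : ∀ t ∈ Icc 1 d, c t < n)
    (hmono : ∀ t t', 1 ≤ t → t ≤ t' → t' ≤ d → c t ≤ c t') (ha : ∀ i, seqVec n d c i < a i)
    (e : ℕ) : lexRank a (d + e) (seqVec n d c) = ∑ t ∈ Icc 1 d, tailCard a (c t) (t + e) := by
  classical
  induction d with
  | zero =>
    have : seqVec n 0 c = 0 := by funext; simp [seqVec]
    rw [this, lexRank, filter_false_of_mem]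
    · simp
    · intro u _ h
      obtain ⟨i, -, h⟩ := toLex_lt_iff.1 h
      simp at h
  | succ d ih =>
    have hd := hc (d + 1) (by simp)
    obtain ⟨i, hi⟩ : ∃ i : Fin n, c (d + 1) = n - 1 - i :=
      ⟨⟨n - 1 - c (d + 1), by omega⟩, by simp; omega⟩
    rw [seqVec_succ hi] at ha ⊢
    rw [add_right_comm, lexRank_add_single, ← hi, sum_Icc_succ_top (by omega), ih, add_right_comm d]
    · exact fun t ht => hc t (mem_Icc.2 (by rw [mem_Icc] at ht; omega))
    · exact fun t t' h h' h'' => hmono t t' h h' (by omega)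
    · exact fun j => lt_of_le_of_lt (by simp) (ha j)
    · intro j hj
      simp only [seqVec, card_eq_zero, filter_eq_empty_iff]
      intro t ht h
      rw [mem_Icc] at ht
      have := hmono t (d + 1) ht.1 (by omega) le_rfl
      have := Fin.lt_def.1 hj
      have := i.2
      omega
    · simpa using ha i

lemma exists_seqVec_eq {n : ℕ} (d : ℕ) (m : Fin n → ℕ) (hm : ∑ i, m i = d) :
    ∃ c : ℕ → ℕ, (∀ t ∈ Icc 1 d, c t < n) ∧
      (∀ t t', 1 ≤ t → t ≤ t' → t' ≤ d → c t ≤ c t') ∧ seqVec n d c = m := by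
  induction d generalizing m with
  | zero =>
    refine ⟨fun _ => 0, by simp, by simp, ?_⟩
    funext i
    simp [seqVec, (sum_eq_zero_iff.1 hm) i]
  | succ d ih =>
    have hne : (univ.filter fun i => 0 < m i).Nonempty := by
      by_contra h
      rw [not_nonempty_iff_eq_empty, filter_eq_empty_iff] at h
      have : ∑ i, m i = 0 := sum_eq_zero fun i hi => by simpa using h hi
      omega
    obtain ⟨i, hi, hmin⟩ := exists_min_image _ id hne
    simp only [mem_filter, mem_univ, true_and, id] at hi hmin
    have hm' : (m - Pi.single i 1) + Pi.single i 1 = m :=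
        sub_single_add_single (by omega)
    have hsum := sum_add_single (m - Pi.single i 1) i
    rw [hm'] at hsum
    obtain ⟨c, hc, hmono, hcm⟩ := ih (m - Pi.single i 1) (by omega)
    have hi2 := i.2
    have hle (t) (ht : t ∈ Icc 1 d) : c t ≤ n - 1 - i := by
      have h1 := hc t ht
      have h2 : 0 < seqVec n d c ⟨n - 1 - c t, by omega⟩ :=
        card_pos.2 ⟨t, mem_filter.2 ⟨ht, by simp; omega⟩⟩
      rw [hcm] at h2
      have := Fin.le_def.1 (hmin _ (h2.trans_le (Nat.sub_le _ _)))
      simp at this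
      omega
    have hcongr (t) (ht : t ≤ d) : Function.update c (d + 1) (n - 1 - i) t = c t :=
      Function.update_of_ne (by omega) _ _
    refine ⟨Function.update c (d + 1) (n - 1 - i), fun t ht => ?_, fun t t' h h' h'' => ?_, ?_⟩
    · rw [mem_Icc] at ht
      by_cases htd : t ≤ d
      · rw [hcongr t htd]
        exact hc t (mem_Icc.2 ⟨ht.1, htd⟩)
      · obtain rfl : t = d + 1 := by omega
        rw [Function.update_self]
        omega
    · by_cases htd' : t' ≤ d
      · rw [hcongr t' htd', hcongr t (by omega)]
        exact hmono t t' h h' htd'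
      · obtain rfl : t' = d + 1 := by omega
        rw [Function.update_self]
        by_cases htd : t ≤ d
        · rw [hcongr t htd]
          exact hle t (mem_Icc.2 ⟨h, htd⟩)
        · obtain rfl : t = d + 1 := by omega
          rw [Function.update_self]
    · rw [seqVec_succ (i := i) (Function.update_self ..), ← hm', ← hcm]
      congr 1
      funext j
      simp only [seqVec]
      congr 1
      refine filter_congr fun t ht => ?_
      rw [hcongr t (mem_Icc.1 ht).2]

open Classical in
lemma IsLexUpper.card_upShadow_add_lexRank {n : ℕ} {a : Fin n → ℕ} {d : ℕ}
    {L : Finset (Fin n → ℕ)} (hL : IsLexUpper a d L) {m : Fin n → ℕ} (hm : m ∈ box a d)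
    (hc : #L + lexRank a d m = #(box a d)) :
    #(ClementsLindstrom.upShadow a L) + lexRank a (d + 1) m = #(box a (d + 1)) := by
  have hL' : IsLexUpper a d {u ∈ box a d | ¬ toLex u < toLex m} := by
    refine ⟨filter_subset _ _, fun s hs t ht hst => ?_⟩
    rw [mem_filter] at hs ⊢
    exact ⟨ht, fun h => hs.2 (hst.trans_lt h)⟩
  have hcard := card_filter_add_card_filter_not (s := box a d) (fun u => toLex u < toLex m)
  have hcard' := card_filter_add_card_filter_not (s := box a (d + 1)) (fun u => toLex u < toLex m)
  have hLeq := hL.eq_of_card_eq hL' (by unfold lexRank at hc; omega)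
  have hup : ClementsLindstrom.upShadow a L = {u ∈ box a (d + 1) | ¬ toLex u < toLex m} := by
    subst hLeq
    ext u
    rw [mem_filter]
    constructor
    · intro hu
      refine ⟨upShadow_subset_box hL.1 hu, fun h => ?_⟩
      obtain ⟨-, s, hs, i, rfl⟩ := mem_upShadow.1 hu
      exact (mem_filter.1 hs).2 ((toLex_lt_add_single s i).trans h)
    · rintro ⟨hu, hum⟩
      obtain ⟨hu1, hu2⟩ := mem_box.1 hu
      have hsum := (mem_box.1 hm).2
      have hne : toLex m ≠ toLex u := by
        intro h
        rw [toLex.injective h] at hsum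
        omega
      obtain ⟨j, v, rfl, hv⟩ := exists_add_single_eq (lt_of_le_of_ne (not_lt.1 hum) hne)
        (by omega)
      refine mem_upShadow.2 ⟨hu1, v, mem_filter.2 ⟨mem_box.2 ⟨fun l => ?_, ?_⟩, not_lt.2 hv⟩,
        j, rfl⟩
      · exact lt_of_le_of_lt (by simp) (hu1 l)
      · rw [sum_add_single] at hu2
        omega
  rw [hup, add_comm]
  exact hcard'

lemma exists_lexRank_eq {n : ℕ} {a : Fin n → ℕ} {d k : ℕ} (hk : k < #(box a d)) :
    ∃ m ∈ box a d, lexRank a d m = k := by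
  classical
  obtain ⟨L, hL, hLc⟩ := exists_isLexUpper a d (#(box a d) - k) (by omega)
  have hne : L.Nonempty := card_pos.1 (by omega)
  obtain ⟨m, hm, hmin⟩ := exists_min_image L (fun u => toLex u) hne
  refine ⟨m, hL.1 hm, ?_⟩
  have : L = {u ∈ box a d | ¬ toLex u < toLex m} := by
    ext u
    rw [mem_filter]
    exact ⟨fun h => ⟨hL.1 h, not_lt.2 (hmin u h)⟩, fun h => hL.2 m hm u h.1 (not_lt.1 h.2)⟩
  have hcard := card_filter_add_card_filter_not (s := box a d) (fun u => toLex u < toLex m)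
  rw [← this] at hcard
  unfold lexRank
  omega

/-- The bounds on exponents given by `a`, truncated at `N`. -/
def bound {r : ℕ} (n : ℕ) (a : Fin r → ℕ) (N : ℕ) : Fin n → ℕ :=
  fun i => if h : (i : ℕ) < r then min (a ⟨i, h⟩) N else N

lemma bound_monotone {n r : ℕ} {a : Fin r → ℕ} (ha : Monotone a) (N : ℕ) :
    Monotone (bound n a N) := by
  intro i j hij
  rw [Fin.le_def] at hij
  unfold bound
  split_ifs with h1 h2 h2
  · exact min_le_min_right _ (ha (Fin.le_def.2 hij))
  · exact min_le_right _ _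
  · omega
  · rfl

section Bound

variable {n r : ℕ} (hrn : r ≤ n) {a : Fin r → ℕ} {N d : ℕ}

lemma mem_box_bound (hN : d < N) {u : Fin n → ℕ} :
    u ∈ box (bound n a N) d ↔ (∀ i, u (Fin.castLE hrn i) < a i) ∧ ∑ i, u i = d := by
  rw [mem_box]
  refine and_congr_left fun hu => ?_
  have hle (i) : u i ≤ d := hu ▸ single_le_sum (f := u) (fun _ _ => Nat.zero_le _) (mem_univ i)
  constructor
  · intro h i
    have := h (Fin.castLE hrn i)
    simp only [bound, Fin.val_castLE, i.2, dif_pos] at this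
    exact this.trans_le (min_le_left _ _)
  · intro h i
    have := hle i
    unfold bound
    split_ifs with hi
    · exact lt_min (h ⟨i, hi⟩) (by omega)
    · omega

lemma cldim_eq (hpos : ∀ i, 0 < a i) (hN : d < N) (h : ℕ) :
    cldim hrn a h d = tailCard (bound n a N) h d := by
  rw [cldim, tailCard, ← Set.ncard_coe_finset,
    ← Set.ncard_image_of_injective _ (Finsupp.equivFunOnFinite (α := Fin n) (M := ℕ)).injective]
  congr 1
  ext u
  simp only [Set.mem_image, Set.mem_ofPred_eq, coe_filter, mem_box_bound hrn hN, expDeg]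
  constructor
  · rintro ⟨m, ⟨h1, h2, h3⟩, rfl⟩
    refine ⟨⟨fun i => ?_, h1⟩, h2⟩
    by_cases hi : n - h ≤ i
    · exact h3 i hi
    · have := h2 (Fin.castLE hrn i) (not_le.1 hi)
      simp only [Finsupp.equivFunOnFinite_apply]
      rw [this]
      exact hpos i
  · rintro ⟨⟨h1, h2⟩, h3⟩
    exact ⟨Finsupp.equivFunOnFinite.symm u, ⟨h2, h3, fun i _ => h1 i⟩, by simp⟩

end Bound

lemma tailCard_self {n : ℕ} (a : Fin n → ℕ) (d : ℕ) : tailCard a n d = #(box a d) := by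
  simp [tailCard]

lemma tailCard_succ_eq_zero {n : ℕ} {a : Fin n → ℕ} {h d : ℕ} (h0 : tailCard a h d = 0) :
    tailCard a h (d + 1) = 0 := by
  unfold tailCard at h0 ⊢
  rw [card_eq_zero, filter_eq_empty_iff] at h0 ⊢
  intro u hu hut
  obtain ⟨hu1, hu2⟩ := mem_box.1 hu
  obtain ⟨v, i, rfl, hv⟩ := exists_eq_add_single hu2
  refine h0 (x := v) (mem_box.2 ⟨fun l => lt_of_le_of_lt (Nat.le_add_right _ _) (hu1 l), hv⟩)
    fun l hl => Nat.eq_zero_of_add_eq_zero_right (hut l hl)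

section MacRep

variable {n r : ℕ} (hrn : r ≤ n) {a : Fin r → ℕ} {N d : ℕ}

lemma card_upShadow_add_of_macRep (hpos : ∀ i, 0 < a i) (hN : d + 1 < N) (hd : 1 ≤ d) {k : ℕ}
    {c : ℕ → ℕ} (hc : MacRep hrn a d k c) {L : Finset (Fin n → ℕ)}
    (hL : IsLexUpper (bound n a N) d L) (hLk : #L + k = #(box (bound n a N) d)) :
    #(upShadow (bound n a N) L) + ∑ t ∈ Icc 1 d, cldim hrn a (c t) (t + 1) =
      #(box (bound n a N) (d + 1)) := by
  obtain ⟨hk, hcn, hmono, hcount, -⟩ := hc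
  have hk' : k = ∑ t ∈ Icc 1 d, tailCard (bound n a N) (c t) t := by
    rw [hk]
    refine sum_congr rfl fun t ht => cldim_eq hrn hpos ?_ _
    rw [mem_Icc] at ht
    omega
  have hsum : ∑ t ∈ Icc 1 d, cldim hrn a (c t) (t + 1) =
      ∑ t ∈ Icc 1 d, tailCard (bound n a N) (c t) (t + 1) := by
    refine sum_congr rfl fun t ht => cldim_eq hrn hpos ?_ _
    rw [mem_Icc] at ht
    omega
  rw [hsum]
  by_cases hcd : c d < n
  · have hcn' : ∀ t ∈ Icc 1 d, c t < n := fun t ht => by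
      rw [mem_Icc] at ht
      exact (hmono t d ht.1 ht.2 le_rfl).trans_lt hcd
    have hlt : ∀ i, seqVec n d c i < bound n a N i := by
      intro i
      have hcard : seqVec n d c i ≤ d := (card_filter_le _ _).trans (by simp)
      unfold bound
      split_ifs with hi
      · refine lt_min ?_ (by omega)
        have h1 := hcount (n - 1 - i) (by omega) (by omega)
        have h2 : (⟨n - (n - 1 - i) - 1, by omega⟩ : Fin r) = ⟨i, hi⟩ := by
          ext
          simp only
          omega
        rw [h2] at h1
        have := hpos ⟨i, hi⟩
        unfold seqVec
        omega
      · omega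
    have h0 := lexRank_seqVec hcn' hmono hlt 0
    have h1 := lexRank_seqVec hcn' hmono hlt 1
    simp only [add_zero] at h0
    rw [← h1]
    exact hL.card_upShadow_add_lexRank (mem_box.2 ⟨hlt, sum_seqVec hcn'⟩) (by rw [h0, ← hk', hLk])
  · obtain ⟨d, rfl⟩ : ∃ e, d = e + 1 := ⟨d - 1, by omega⟩
    have hcd' : c (d + 1) = n := le_antisymm (hcn _ (by simp)) (not_lt.1 hcd)
    rw [sum_Icc_succ_top (by omega), hcd', tailCard_self] at hk' ⊢
    have hL0 : L = ∅ := by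
      rw [← card_eq_zero]
      omega
    have hzero : ∑ t ∈ Icc 1 d, tailCard (bound n a N) (c t) t = 0 := by omega
    have hzero' : ∑ t ∈ Icc 1 d, tailCard (bound n a N) (c t) (t + 1) = 0 :=
      sum_eq_zero fun t ht => tailCard_succ_eq_zero (sum_eq_zero_iff.1 hzero t ht)
    rw [hzero', hL0]
    simp [upShadow]

lemma card_filter_lt_of_seqVec_mem_box {m : Fin n → ℕ} {e : ℕ} {c : ℕ → ℕ}
    (hm : m ∈ box (bound n a N) e) (hcm : seqVec n e c = m) (i : ℕ) (hi : i < n)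
    (hir : n - i ≤ r) : #{t ∈ Icc 1 e | c t = i} ≤ a ⟨n - i - 1, by omega⟩ - 1 := by
  have h1 := (mem_box.1 hm).1 ⟨n - i - 1, by omega⟩
  rw [← hcm] at h1
  unfold bound at h1
  rw [dif_pos (by simp only; omega)] at h1
  have h2 := h1.trans_le (min_le_left _ _)
  simp only [seqVec, show n - 1 - (n - i - 1) = i by omega] at h2
  omega

lemma exists_macRep (hpos : ∀ i, 0 < a i) (hN : d < N) (hd : 1 ≤ d) {k : ℕ} (hk0 : 0 < k)
    (hk : k ≤ #(box (bound n a N) d)) : ∃ c, MacRep hrn a d k c := by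
  have hcl (c : ℕ → ℕ) : ∑ t ∈ Icc 1 d, cldim hrn a (c t) t =
      ∑ t ∈ Icc 1 d, tailCard (bound n a N) (c t) t := by
    refine sum_congr rfl fun t ht => cldim_eq hrn hpos ?_ _
    rw [mem_Icc] at ht
    omega
  rcases hk.lt_or_eq with hk | hk
  · obtain ⟨m, hm, hmk⟩ := exists_lexRank_eq hk
    obtain ⟨hm1, hm2⟩ := mem_box.1 hm
    obtain ⟨c, hcn, hmono, hcm⟩ := exists_seqVec_eq d m hm2
    refine ⟨c, ?_, fun t ht => (hcn t ht).le, hmono, ?_, ?_⟩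
    · rw [hcl, ← hmk, ← hcm]
      exact lexRank_seqVec hcn hmono (by rwa [hcm]) 0
    · exact card_filter_lt_of_seqVec_mem_box hm hcm
    · rw [filter_false_of_mem fun t ht => (hcn t ht).ne]
      simp
  · obtain ⟨d, rfl⟩ : ∃ e, d = e + 1 := ⟨d - 1, by omega⟩
    have hbox : 0 < #(box (bound n a N) d) := by
      by_contra h
      have h0 : tailCard (bound n a N) n d = 0 := by
        rw [tailCard_self]
        omega
      have := tailCard_succ_eq_zero h0
      rw [tailCard_self] at this
      omega
    obtain ⟨m, hm, hm0⟩ := exists_lexRank_eq hbox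
    obtain ⟨hm1, hm2⟩ := mem_box.1 hm
    obtain ⟨c, hcn, hmono, hcm⟩ := exists_seqVec_eq d m hm2
    have hrank := lexRank_seqVec (a := bound n a N) hcn hmono (by rwa [hcm]) 0
    rw [hcm, add_zero, hm0] at hrank
    have hcongr (t) (ht : t ≤ d) : Function.update c (d + 1) n t = c t :=
      Function.update_of_ne (by omega) _ _
    have hins : Icc 1 (d + 1) = insert (d + 1) (Icc 1 d) := by
      ext t
      simp only [mem_Icc, mem_insert]
      omega
    have hfilter (i : ℕ) : {t ∈ Icc 1 d | Function.update c (d + 1) n t = i} =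
        {t ∈ Icc 1 d | c t = i} :=
      filter_congr fun t ht => by rw [hcongr t (mem_Icc.1 ht).2]
    refine ⟨Function.update c (d + 1) n, ?_, fun t ht => ?_, fun t t' h h' h'' => ?_,
      fun i hi hir => ?_, ?_⟩
    · rw [hcl, sum_Icc_succ_top (by omega), Function.update_self, tailCard_self, hk,
        sum_congr rfl fun t ht => by rw [hcongr t (mem_Icc.1 ht).2]]
      simp only [add_zero] at hrank
      rw [← hrank, zero_add]
    · by_cases htd : t ≤ d
      · rw [hcongr t htd]
        exact (hcn t (mem_Icc.2 ⟨(mem_Icc.1 ht).1, htd⟩)).le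
      · obtain rfl : t = d + 1 := by rw [mem_Icc] at ht; omega
        rw [Function.update_self]
    · by_cases htd' : t' ≤ d
      · rw [hcongr t' htd', hcongr t (by omega)]
        exact hmono t t' h h' htd'
      · obtain rfl : t' = d + 1 := by omega
        rw [Function.update_self]
        by_cases htd : t ≤ d
        · rw [hcongr t htd]
          exact (hcn t (mem_Icc.2 ⟨h, htd⟩)).le
        · obtain rfl : t = d + 1 := by omega
          rw [Function.update_self]
    · rw [hins, filter_insert, Function.update_self, if_neg hi.ne', hfilter]
      exact card_filter_lt_of_seqVec_mem_box hm hcm i hi hir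
    · rw [hins, filter_insert, Function.update_self, if_pos rfl, hfilter,
        filter_false_of_mem fun t ht => (hcn t ht).ne]
      simp

end MacRep

open Classical in
lemma finrank_span_image_eq_card {K W α β : Type*} [Field K] [AddCommGroup W] [Module K W]
    [LinearOrder β] (f : α → W) {g : α → β} (hg : Function.Injective g) (s : Finset α) :
    Module.finrank K (Submodule.span K (f '' s)) =
      #{u ∈ s | f u ∉ Submodule.span K (f '' {v | v ∈ s ∧ g v < g u})} := by
  induction s using Finset.induction_on_max_value g with
  | empty => rw [coe_empty, Set.image_empty, Submodule.span_empty, finrank_bot]; simp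
  | insert a s ha hmax ih =>
    have hlt {v} (hv : v ∈ s) : g v < g a :=
      (hmax v hv).lt_of_ne fun h => ha (hg h ▸ hv)
    have hs (u) (hu : u ∈ s) :
        {v | v ∈ insert a s ∧ g v < g u} = {v | v ∈ s ∧ g v < g u} := by
      ext v
      simp only [Set.mem_ofPred_eq, mem_insert]
      constructor
      · rintro ⟨rfl | hv, h⟩
        · exact absurd h (not_lt.2 (hmax u hu))
        · exact ⟨hv, h⟩
      · exact fun h => ⟨Or.inr h.1, h.2⟩
    have hsa : {v | v ∈ insert a s ∧ g v < g a} = (s : Set α) := by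
      ext v
      simp only [Set.mem_ofPred_eq, mem_insert, mem_coe]
      constructor
      · rintro ⟨rfl | hv, h⟩
        · exact absurd h (lt_irrefl _)
        · exact hv
      · exact fun h => ⟨Or.inr h, hlt h⟩
    rw [filter_insert, hsa, filter_congr fun u hu => by rw [hs u hu], coe_insert,
      Set.image_insert_eq, Submodule.span_insert]
    split_ifs with h
    · rw [← ih, sup_eq_right.2 ((Submodule.span_singleton_le_iff_mem _ _).2 h)]
    · have hfa : f a ≠ 0 := fun h0 => h (by rw [h0]; exact Submodule.zero_mem _)
      rw [card_insert_of_notMem fun h' => ha (mem_filter.1 h').1, ← ih]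
      have : FiniteDimensional K (Submodule.span K (f '' s)) :=
        FiniteDimensional.span_of_finite K (s.finite_toSet.image f)
      have hd : Submodule.span K {f a} ⊓ Submodule.span K (f '' s) = ⊥ :=
        ((Submodule.disjoint_span_singleton' hfa).2 h).symm.eq_bot
      have key := Submodule.finrank_sup_add_finrank_inf_eq (Submodule.span K {f a})
        (Submodule.span K (f '' s))
      rw [hd, finrank_bot, finrank_span_singleton hfa] at key
      omega

section Standard

variable {K : Type*} [Field K] {n : ℕ}

/-- The monomial with exponent vector `u`. -/
noncomputable def mon (K : Type*) [Field K] {n : ℕ} (u : Fin n → ℕ) : MvPolynomial (Fin n) K :=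
  monomial (Finsupp.equivFunOnFinite.symm u) 1

lemma mon_add_single (u : Fin n → ℕ) (i : Fin n) : mon K (u + Pi.single i 1) = X i * mon K u := by
  rw [mon, mon, X, monomial_mul, one_mul]
  have h : Finsupp.equivFunOnFinite.symm (u + Pi.single i 1) =
      Finsupp.single i 1 + Finsupp.equivFunOnFinite.symm u := by
    ext l
    simp [Finsupp.single_apply, Pi.single_apply, add_comm, eq_comm]
  rw [h]

lemma homogeneousSubmodule_eq_span (d : ℕ) :
    homogeneousSubmodule (Fin n) K d = Submodule.span K (mon K '' {u | ∑ i, u i = d}) := by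
  apply le_antisymm
  · intro f hf
    rw [f.as_sum]
    refine Submodule.sum_mem _ fun m hm => ?_
    have hmd := hf (mem_support_iff.1 hm)
    rw [← mul_one (coeff m f), ← smul_eq_mul, ← smul_monomial]
    refine Submodule.smul_mem _ _ (Submodule.subset_span ⟨m, ?_, ?_⟩)
    · simpa [Finsupp.weight_apply, Finsupp.sum_fintype] using hmd
    · rw [mon]
      congr
      ext
      simp
  · rw [Submodule.span_le]
    rintro _ ⟨u, hu, rfl⟩
    refine isHomogeneous_monomial _ ?_
    simpa [Finsupp.degree_eq_sum] using hu

/-- The monomial of exponent `u` is a combination of lexicographically smaller ones modulo `I`. -/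
def IsReducible (I : Ideal (MvPolynomial (Fin n) K)) (u : Fin n → ℕ) : Prop :=
  mon K u ∈ Submodule.restrictScalars K I ⊔
    Submodule.span K (mon K '' {v | ∑ i, v i = ∑ i, u i ∧ toLex v < toLex u})

open Classical in
lemma hilbQ_eq_card (I : Ideal (MvPolynomial (Fin n) K)) (d : ℕ) {T : Finset (Fin n → ℕ)}
    (hT : ∀ u, u ∈ T ↔ ∑ i, u i = d ∧ ¬ IsReducible I u) : hilbQ I d = #T := by
  set P := Submodule.mkQ (Submodule.restrictScalars K I)
  have hM (u : Fin n → ℕ) : u ∈ box (fun _ : Fin n => d + 1) d ↔ ∑ i, u i = d := by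
    rw [mem_box, and_iff_right_iff_imp]
    intro hu i
    have := single_le_sum (f := u) (fun _ _ => Nat.zero_le _) (mem_univ i)
    omega
  have h1 : hilbQ I d = Module.finrank K ((homogeneousSubmodule (Fin n) K d).map P) := by
    have hk : LinearMap.ker (P ∘ₗ (homogeneousSubmodule (Fin n) K d).subtype) =
        Submodule.comap (homogeneousSubmodule (Fin n) K d).subtype
          (Submodule.restrictScalars K I) := by
      rw [LinearMap.ker_comp, Submodule.ker_mkQ]
    have hr : LinearMap.range (P ∘ₗ (homogeneousSubmodule (Fin n) K d).subtype) =
        (homogeneousSubmodule (Fin n) K d).map P := by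
      rw [LinearMap.range_comp, Submodule.range_subtype]
    rw [hilbQ, ← hk, ← hr]
    exact (LinearMap.quotKerEquivRange _).finrank_eq
  have h2 : (homogeneousSubmodule (Fin n) K d).map P =
      Submodule.span K ((fun u => P (mon K u)) '' (box (fun _ : Fin n => d + 1) d)) := by
    rw [homogeneousSubmodule_eq_span, Submodule.map_span, Set.image_image]
    congr 2
    ext u
    exact (hM u).symm
  rw [h1, h2, finrank_span_image_eq_card _ (g := toLex) toLex.injective]
  congr 1
  ext u
  rw [mem_filter, hM, hT]
  refine and_congr_right fun hu => not_congr ?_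
  rw [IsReducible, ← Submodule.comap_map_mkQ, Submodule.mem_comap, Submodule.map_span,
    Set.image_image]
  simp only [hM, hu]
  rfl

lemma IsReducible.add_single {I : Ideal (MvPolynomial (Fin n) K)} {u : Fin n → ℕ}
    (h : IsReducible I u) (i : Fin n) : IsReducible I (u + Pi.single i 1) := by
  obtain ⟨f, hf, g, hg, hfg⟩ := Submodule.mem_sup.1 h
  rw [IsReducible, mon_add_single, ← hfg, mul_add]
  refine add_mem (Submodule.mem_sup_left (I.mul_mem_left _ hf)) (Submodule.mem_sup_right ?_)
  clear hfg
  induction hg using Submodule.span_induction with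
  | mem x hx =>
    obtain ⟨v, ⟨hv, hlt⟩, rfl⟩ := hx
    rw [← mon_add_single]
    refine Submodule.subset_span ⟨_, ⟨?_, ?_⟩, rfl⟩
    · rw [sum_add_single, sum_add_single, hv]
    · exact add_lt_add_left hlt (toLex (Pi.single i 1))
  | zero => simp
  | add x y _ _ hx hy =>
    rw [mul_add]
    exact add_mem hx hy
  | smul c x _ hx =>
    rw [mul_smul_comm]
    exact Submodule.smul_mem _ _ hx

lemma isReducible_of_mem {I : Ideal (MvPolynomial (Fin n) K)} {u : Fin n → ℕ}
    (h : mon K u ∈ I) : IsReducible I u := Submodule.mem_sup_left h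

lemma mon_mem_purePowers {r : ℕ} {hrn : r ≤ n} {a : Fin r → ℕ} {u : Fin n → ℕ} {i : Fin r}
    (h : a i ≤ u (Fin.castLE hrn i)) : mon K u ∈ purePowers K hrn a := by
  refine Ideal.mem_of_dvd _ ?_ (Ideal.subset_span ⟨i, rfl⟩)
  simp only [X_pow_eq_monomial, mon, monomial_dvd_monomial]
  refine ⟨Or.inr fun l => ?_, one_dvd _⟩
  by_cases hl : l = Fin.castLE hrn i
  · subst hl
    simpa using h
  · simp [Ne.symm hl]

/-- The monomial ideal whose set of exponent vectors is the upward closed set `U`. -/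
noncomputable def monIdeal (K : Type*) [Field K] {n : ℕ} (U : Set (Fin n → ℕ)) :
    Ideal (MvPolynomial (Fin n) K) :=
  Ideal.span (mon K '' U)

lemma mem_monIdeal {U : Set (Fin n → ℕ)} (hU : IsUpperSet U) {f : MvPolynomial (Fin n) K} :
    f ∈ monIdeal K U ↔ ∀ m ∈ f.support, ⇑m ∈ U := by
  have : mon K '' U =
      (fun m => monomial m (1 : K)) '' (Finsupp.equivFunOnFinite.symm '' U) := by
    rw [Set.image_image]
    rfl
  rw [monIdeal, this, mem_ideal_span_monomial_image]
  refine forall₂_congr fun m hm => ⟨?_, fun h => ⟨m, ⟨m, h, by ext; simp⟩, le_rfl⟩⟩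
  rintro ⟨_, ⟨u, hu, rfl⟩, h⟩
  exact hU (fun i => h i) hu

lemma isHomog_monIdeal {U : Set (Fin n → ℕ)} (hU : IsUpperSet U) : IsHomog (monIdeal K U) := by
  intro f hf d
  rw [mem_monIdeal hU] at hf ⊢
  intro m hm
  rw [mem_support_iff, coeff_homogeneousComponent] at hm
  refine hf m (mem_support_iff.2 fun h0 => hm ?_)
  simp [h0]

lemma isReducible_monIdeal {U : Set (Fin n → ℕ)} (hU : IsUpperSet U) {u : Fin n → ℕ} :
    IsReducible (monIdeal K U) u ↔ u ∈ U := by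
  constructor
  · intro h
    obtain ⟨f, hf, g, hg, hfg⟩ := Submodule.mem_sup.1 h
    have hg0 : coeff (Finsupp.equivFunOnFinite.symm u) g = 0 := by
      clear hfg
      induction hg using Submodule.span_induction with
      | mem x hx =>
        obtain ⟨v, ⟨-, hlt⟩, rfl⟩ := hx
        rw [mon, coeff_monomial, if_neg]
        intro h
        rw [Finsupp.equivFunOnFinite.symm.injective h] at hlt
        exact lt_irrefl _ hlt
      | zero => simp
      | add x y _ _ hx hy => simp [hx, hy]
      | smul c x _ hx => simp [hx]
    have hf1 : coeff (Finsupp.equivFunOnFinite.symm u) f = 1 := by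
      have := congrArg (coeff (Finsupp.equivFunOnFinite.symm u)) hfg
      rwa [coeff_add, hg0, add_zero, mon, coeff_monomial, if_pos rfl] at this
    have := (mem_monIdeal hU).1 hf _ (mem_support_iff.2 (hf1 ▸ one_ne_zero))
    simpa using this
  · exact fun h => isReducible_of_mem (Ideal.subset_span ⟨u, h, rfl⟩)

end Standard

lemma isLexUpper_box {n : ℕ} (a : Fin n → ℕ) (d : ℕ) : IsLexUpper a d (box a d) :=
  ⟨Subset.rfl, fun _ _ _ ht _ => ht⟩

lemma upShadow_box {n : ℕ} (a : Fin n → ℕ) (d : ℕ) : upShadow a (box a d) = box a (d + 1) := by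
  refine (upShadow_subset_box Subset.rfl).antisymm fun u hu => ?_
  obtain ⟨hu1, hu2⟩ := mem_box.1 hu
  obtain ⟨v, i, rfl, hv⟩ := exists_eq_add_single hu2
  exact mem_upShadow.2 ⟨hu1, v,
    mem_box.2 ⟨fun l => lt_of_le_of_lt (Nat.le_add_right _ _) (hu1 l), hv⟩, i, rfl⟩

lemma isUpperSet_of_add_single {n : ℕ} {U : Set (Fin n → ℕ)}
    (h : ∀ u ∈ U, ∀ i, u + Pi.single i 1 ∈ U) : IsUpperSet U := by
  intro u v huv hu
  obtain ⟨k, hk⟩ : ∃ k, k = ∑ i, (v i - u i) := ⟨_, rfl⟩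
  induction k generalizing u with
  | zero =>
    have : v = u := by
      funext i
      have h1 := sum_eq_zero_iff.1 hk.symm i (mem_univ i)
      have h2 : u i ≤ v i := huv i
      omega
    rwa [this]
  | succ k ih =>
    obtain ⟨i, -, hi⟩ := exists_ne_zero_of_sum_ne_zero (by omega : ∑ i, (v i - u i) ≠ 0)
    have hui : u i < v i := Nat.lt_of_sub_ne_zero hi
    refine ih (u := u + Pi.single i 1) (fun l => ?_) (h u hu i) ?_
    · have := huv l
      by_cases hl : l = i
      · subst hl
        simpa using hui
      · simpa [hl] using this
    · have : ∑ l, (v l - (u + Pi.single i 1 : Fin n → ℕ) l) + 1 = ∑ l, (v l - u l) := by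
        rw [← sum_add_single _ i]
        refine sum_congr rfl fun l _ => ?_
        by_cases hl : l = i
        · subst hl; simp; omega
        · simp [hl]
      omega

/-- Passing from codimension `k` in degree `d` to codimension `k'` in degree `d + 1` is compatible
with the growth of lexicographically upper sets. -/
def LexGrowth {r : ℕ} (n : ℕ) (a : Fin r → ℕ) (d k k' : ℕ) : Prop :=
  ∀ L, IsLexUpper (bound n a (d + 2)) d L → #L + k = #(box (bound n a (d + 2)) d) →
    #(upShadow (bound n a (d + 2)) L) + k' ≤ #(box (bound n a (d + 2)) (d + 1))

section Growth

variable {n r : ℕ} {a : Fin r → ℕ} {d k k' : ℕ}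

lemma LexGrowth.le_card_box (h : LexGrowth n a d k k')
    (hk : k ≤ #(box (bound n a (d + 2)) d)) : k' ≤ #(box (bound n a (d + 2)) (d + 1)) := by
  have := h _ (isLexUpper_lexUpper (Nat.sub_le _ k)) (by rw [card_lexUpper (Nat.sub_le _ k)]; omega)
  omega

lemma box_bound_eq (hrn : r ≤ n) {N N' : ℕ} (hN : d < N) (hN' : d < N') :
    box (bound n a N) d = box (bound n a N') d := by
  ext u
  rw [mem_box_bound hrn hN, mem_box_bound hrn hN']

lemma card_box_bound_zero (hrn : r ≤ n) (hpos : ∀ i, 0 < a i) : #(box (bound n a 2) 0) = 1 := by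
  rw [card_eq_one]
  refine ⟨0, ?_⟩
  ext u
  rw [mem_box_bound hrn (by omega), mem_singleton]
  constructor
  · rintro ⟨-, h⟩
    funext i
    exact sum_eq_zero_iff.1 h i (mem_univ i)
  · rintro rfl
    exact ⟨hpos, by simp⟩

variable (hrn : r ≤ n)

lemma lexGrowth_iff (hpos : ∀ i, 0 < a i) (hd : 1 ≤ d) (hk : k ≤ #(box (bound n a (d + 2)) d)) :
    LexGrowth n a d k k' ↔ (k = 0 → k' = 0) ∧ (0 < k → ∃ c : ℕ → ℕ, MacRep hrn a d k c ∧
      k' ≤ ∑ t ∈ Icc 1 d, cldim hrn a (c t) (t + 1)) := by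
  constructor
  · refine fun h => ⟨?_, fun hk0 => ?_⟩
    · rintro rfl
      have := h _ (isLexUpper_box _ d) (add_zero _)
      rw [upShadow_box] at this
      omega
    · obtain ⟨c, hc⟩ := exists_macRep hrn hpos (by omega) hd hk0 hk
      have hL := isLexUpper_lexUpper (Nat.sub_le #(box (bound n a (d + 2)) d) k)
      have hLk : #(lexUpper (bound n a (d + 2)) d (#(box (bound n a (d + 2)) d) - k)) + k =
          #(box (bound n a (d + 2)) d) := by
        rw [card_lexUpper (Nat.sub_le _ k)]
        omega
      have h1 := h _ hL hLk
      have h2 := card_upShadow_add_of_macRep hrn hpos (by omega) hd hc hL hLk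
      exact ⟨c, hc, by omega⟩
  · rintro ⟨h0, h1⟩ L hL hLk
    rcases k.eq_zero_or_pos with hk0 | hk0
    · rw [h0 hk0]
      exact card_le_card (upShadow_subset_box hL.1)
    · obtain ⟨c, hc, hle⟩ := h1 hk0
      have := card_upShadow_add_of_macRep hrn hpos (by omega) hd hc hL hLk
      omega

variable {K : Type*} [Field K]

open Classical in
lemma hilbQ_eq_card_filter_box {I : Ideal (MvPolynomial (Fin n) K)} (hI : purePowers K hrn a ≤ I)
    {N : ℕ} (hN : d < N) : hilbQ I d = #{u ∈ box (bound n a N) d | ¬ IsReducible I u} := by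
  refine hilbQ_eq_card I d fun u => ?_
  rw [mem_filter, mem_box_bound hrn hN]
  refine ⟨fun h => ⟨h.1.2, h.2⟩, fun h => ⟨⟨fun i => ?_, h.1⟩, h.2⟩⟩
  by_contra hi
  exact h.2 (isReducible_of_mem (hI (mon_mem_purePowers (not_lt.1 hi))))

lemma hilbQ_le_card_box {I : Ideal (MvPolynomial (Fin n) K)} (hI : purePowers K hrn a ≤ I)
    {N : ℕ} (hN : d < N) : hilbQ I d ≤ #(box (bound n a N) d) := by
  classical
  rw [hilbQ_eq_card_filter_box hrn hI hN]
  exact card_filter_le _ _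

lemma lexGrowth_hilbQ (ha : Monotone a) {I : Ideal (MvPolynomial (Fin n) K)}
    (hI : purePowers K hrn a ≤ I) : LexGrowth n a d (hilbQ I d) (hilbQ I (d + 1)) := by
  classical
  intro L hL hLk
  set R : ℕ → Finset (Fin n → ℕ) := fun e => {u ∈ box (bound n a (d + 2)) e | IsReducible I u}
  have hadd (e) (he : e < d + 2) : #(R e) + hilbQ I e = #(box (bound n a (d + 2)) e) := by
    rw [hilbQ_eq_card_filter_box hrn hI he]
    exact card_filter_add_card_filter_not _
  have h0 := hadd d (by omega)
  have h1 := hadd (d + 1) (by omega)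
  have h2 := card_upShadow_le (bound_monotone ha (d + 2)) (S := R d) (filter_subset _ _) hL
    (by omega)
  have h3 : upShadow (bound n a (d + 2)) (R d) ⊆ R (d + 1) := by
    refine fun u hu => mem_filter.2 ⟨upShadow_subset_box (filter_subset _ _) hu, ?_⟩
    obtain ⟨-, s, hs, i, rfl⟩ := mem_upShadow.1 hu
    exact (mem_filter.1 hs).2.add_single i
  have h4 := card_le_card h3
  omega

lemma exists_hilbQ_eq {H : ℕ → ℕ} (hle : ∀ e, H e ≤ #(box (bound n a (e + 2)) e))
    (hgrow : ∀ e, LexGrowth n a e (H e) (H (e + 1))) :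
    ∃ I : Ideal (MvPolynomial (Fin n) K), IsHomog I ∧ purePowers K hrn a ≤ I ∧
      ∀ d, hilbQ I d = H d := by
  classical
  set L : ℕ → Finset (Fin n → ℕ) := fun e =>
    lexUpper (bound n a (e + 2)) e (#(box (bound n a (e + 2)) e) - H e)
  have hL (e) : IsLexUpper (bound n a (e + 2)) e (L e) := isLexUpper_lexUpper (Nat.sub_le _ _)
  have hLk (e) : #(L e) + H e = #(box (bound n a (e + 2)) e) := by
    have := card_lexUpper (Nat.sub_le #(box (bound n a (e + 2)) e) (H e))
    have := hle e
    simp only [L]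
    omega
  have hLL (e) : upShadow (bound n a (e + 2)) (L e) ⊆ L (e + 1) := by
    have hbox : box (bound n a (e + 1 + 2)) (e + 1) = box (bound n a (e + 2)) (e + 1) :=
      box_bound_eq hrn (by omega) (by omega)
    have hL' : IsLexUpper (bound n a (e + 2)) (e + 1) (L (e + 1)) := by
      have := hL (e + 1)
      rwa [IsLexUpper, hbox] at this
    refine (hL e).upShadow.subset_of_card_le hL' ?_
    have h1 := hgrow e _ (hL e) (hLk e)
    have h2 := hLk (e + 1)
    rw [hbox] at h2
    omega
  set U : Set (Fin n → ℕ) :=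
    {u | (∃ i, a i ≤ u (Fin.castLE hrn i)) ∨ u ∈ L (∑ i, u i)}
  have hU : IsUpperSet U := by
    refine isUpperSet_of_add_single fun u hu i => ?_
    rcases hu with ⟨j, hj⟩ | hu
    · exact Or.inl ⟨j, hj.trans (Nat.le_add_right _ _)⟩
    · by_cases hb : ∃ j, a j ≤ (u + Pi.single i 1 : Fin n → ℕ) (Fin.castLE hrn j)
      · exact Or.inl hb
      · refine Or.inr ?_
        push Not at hb
        rw [sum_add_single]
        refine hLL _ (mem_upShadow.2 ⟨?_, u, hu, i, rfl⟩)
        exact (mem_box.1 ((mem_box_bound hrn (by omega)).2 ⟨hb, sum_add_single u i⟩)).1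
  have hpp : purePowers K hrn a ≤ monIdeal K U := by
    rw [purePowers, Ideal.span_le]
    rintro _ ⟨i, rfl⟩
    refine (mem_monIdeal hU).2 fun m hm => Or.inl ⟨i, ?_⟩
    simp only [X_pow_eq_monomial] at hm
    rw [mem_singleton.1 (support_monomial_subset hm)]
    simp
  refine ⟨monIdeal K U, isHomog_monIdeal hU, hpp, fun d => ?_⟩
  rw [hilbQ_eq_card_filter_box hrn hpp (by omega : d < d + 2)]
  have hfilter : {u ∈ box (bound n a (d + 2)) d | ¬ IsReducible (monIdeal K U) u} =
      box (bound n a (d + 2)) d \ L d := by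
    ext u
    rw [mem_filter, mem_sdiff, isReducible_monIdeal hU]
    refine and_congr_right fun hu => not_congr ?_
    obtain ⟨hu1, hu2⟩ := (mem_box_bound hrn (by omega)).1 hu
    refine ⟨?_, fun h => Or.inr (by rwa [hu2])⟩
    rintro (⟨i, hi⟩ | h)
    · exact absurd (hu1 i) (not_lt.2 hi)
    · rwa [hu2] at h
  rw [hfilter, card_sdiff_of_subset (hL d).1]
  have := hLk d
  omega

end Growth

end ClementsLindstrom

open ClementsLindstrom in
/-- **Macaulay's theorem for Clements–Lindström rings.**  Let `𝔞` be the pure-powers ideal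
of a degree sequence `a` in `A = K[x_1,…,x_n]`, and `R = A/𝔞`.  A numerical function `H`
with `H(0) = 1` and `H(1) ≤ n` is the Hilbert function of `R/I` for some homogeneous ideal
`I` of `R` (equivalently, of `A/I` for a homogeneous ideal `𝔞 ≤ I ≤ A`) if and only if
`H(d+1) ≤ H(d)^{⟨d⟩}_a` for all `d ≥ 1`, where the bound is computed from the
`(a,n)`-Macaulay representation of `H(d)` (and `0^{⟨d⟩}_a = 0`). -/
theorem macaulay_clements_lindstrom {K : Type*} [Field K] {n r : ℕ} (hrn : r ≤ n)
    (a : Fin r → ℕ) (hpos : ∀ i, 0 < a i) (hmono : Monotone a)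
    (H : ℕ → ℕ) (hH0 : H 0 = 1) (hH1 : H 1 ≤ n) :
    (∃ I : Ideal (MvPolynomial (Fin n) K), IsHomog I ∧ purePowers K hrn a ≤ I ∧
        ∀ d : ℕ, hilbQ I d = H d) ↔
      (∀ d : ℕ, 1 ≤ d →
        (H d = 0 → H (d + 1) = 0) ∧
        (0 < H d → ∃ c : ℕ → ℕ, MacRep hrn a d (H d) c ∧
          H (d + 1) ≤ ∑ t ∈ Finset.Icc 1 d, cldim hrn a (c t) (t + 1))) := by
  constructor
  · rintro ⟨I, -, hI, hH⟩ d hd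
    have hk := hilbQ_le_card_box hrn hI (by omega : d < d + 2)
    have hg := lexGrowth_hilbQ (d := d) hrn hmono hI
    rw [hH] at hk
    rw [hH, hH] at hg
    exact (lexGrowth_iff hrn hpos hd hk).1 hg
  · intro h
    have h1 : H 1 ≤ (box (bound n a 2) 1).card := by
      rcases (H 1).eq_zero_or_pos with h0 | h0
      · omega
      · obtain ⟨c, hc, -⟩ := (h 1 le_rfl).2 h0
        rw [hc.1, Finset.Icc_self, Finset.sum_singleton, cldim_eq hrn hpos (by omega : 1 < 2)]
        exact Finset.card_filter_le _ _
    have hle (e : ℕ) : H e ≤ (box (bound n a (e + 2)) e).card := by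
      induction e with
      | zero => rw [hH0, card_box_bound_zero hrn hpos]
      | succ e ih =>
        rw [box_bound_eq hrn (by omega : e + 1 < e + 1 + 2) (by omega : e + 1 < e + 2)]
        rcases e.eq_zero_or_pos with rfl | he
        · exact h1
        · exact ((lexGrowth_iff hrn hpos he ih).2 (h e he)).le_card_box ih
    refine exists_hilbQ_eq hrn hle fun e => ?_
    rcases e.eq_zero_or_pos with rfl | he
    · intro L hL hLk
      rw [card_box_bound_zero hrn hpos, hH0] at hLk
      rw [Finset.card_eq_zero.1 (by omega : L.card = 0)]
      simpa [upShadow] using h1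
    · exact (lexGrowth_iff hrn hpos he (hle e)).2 (h e he)
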